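/- Let C be an isotropic convex body in ℝⁿ and K a centrally symmetric convex body in ℝⁿ. There is an absolute constant c > 0 such that for every s ≥ 1 and every t ∈ ℝˢ, ∫_C⋯∫_C ‖∑_{j=1}^s t_j x_j‖_K dx₁⋯dx_s ≤ c · L_C · max{n^{1/4}, √(log(1+s))} · √n · M(K) · ‖t‖₂. -/

import Mathlib

open MeasureTheory Real
open scoped ENNReal RealInnerProductSpace

noncomputable section

/-- A convex body: compact, convex, with non-empty interior. -/
def IsConvexBody {n : ℕ} (C : Set (EuclideanSpace ℝ (Fin n))) : Prop :=
  Convex ℝ C ∧ IsCompact C ∧ (interior C).Nonempty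

/-- A centrally symmetric convex body. -/
def IsSymmConvexBody {n : ℕ} (C : Set (EuclideanSpace ℝ (Fin n))) : Prop :=
  Convex ℝ C ∧ IsCompact C ∧ (interior C).Nonempty ∧ C = -C

/-- `C` is isotropic with isotropic constant `L`. -/
def IsIsotropic {n : ℕ} (C : Set (EuclideanSpace ℝ (Fin n))) (L : ℝ) : Prop :=
  volume C = 1 ∧ (∫ x in C, x) = 0 ∧ 0 < L ∧
    ∀ ξ : EuclideanSpace ℝ (Fin n), ‖ξ‖ = 1 → (∫ x in C, ⟪x, ξ⟫ ^ 2) = L ^ 2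

/-- `M(K) = ∫_{S^{n-1}} ‖ξ‖_K dσ(ξ)`: the average of the gauge of `K` over the unit
sphere with respect to the rotation-invariant probability measure (the normalization of
the spherical measure induced by Lebesgue measure). -/
def sphereM {n : ℕ} (K : Set (EuclideanSpace ℝ (Fin n))) : ℝ :=
  ⨍ ξ, gauge K (ξ : EuclideanSpace ℝ (Fin n))
    ∂((volume : Measure (EuclideanSpace ℝ (Fin n))).toSphere)

/-- The Euclidean norm of `t ∈ ℝˢ`. -/
def euclNorm {s : ℕ} (t : Fin s → ℝ) : ℝ := Real.sqrt (∑ j, t j ^ 2)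

open scoped Pointwise in
/-- One-dimensional Brunn–Minkowski inequality for compact sets. -/
lemma volume_add_le_of_isCompact {A B : Set ℝ} (hA : IsCompact A) (hB : IsCompact B)
    (hA' : A.Nonempty) (hB' : B.Nonempty) {D : Set ℝ}
    (hD : ∀ a ∈ A, ∀ b ∈ B, (a + b) / 2 ∈ D) :
    volume A + volume B ≤ 2 * volume D := by
  have ha := hA.sSup_mem hA'
  have hb := hB.sInf_mem hB'
  set a0 := sSup A with ha0
  set b0 := sInf B with hb0
  have hAle : ∀ a ∈ A, a ≤ a0 := fun a h => le_csSup hA.bddAbove h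
  have hBle : ∀ b ∈ B, b0 ≤ b := fun b h => csInf_le hB.bddBelow h
  set A' := (fun x => b0 + x) '' A
  set B' := (fun x => a0 + x) '' B
  have vA : volume A' = volume A := by
    simp [A', measure_preimage_add]
  have vB : volume B' = volume B := by
    simp [B', measure_preimage_add]
  have mB : MeasurableSet B' := (hB.image (by fun_prop)).measurableSet
  have hdis : AEDisjoint volume A' B' := by
    refine measure_mono_null (t := {a0 + b0}) ?_ (by simp)
    rintro x ⟨⟨a, haA, rfl⟩, ⟨b, hbB, h⟩⟩
    have := hAle a haA
    have := hBle b hbB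
    simp only [Set.mem_singleton_iff] at *
    linarith
  have hsub : A' ∪ B' ⊆ (2 : ℝ) • D := by
    rintro x (⟨a, h, rfl⟩ | ⟨b, h, rfl⟩)
    · exact ⟨_, hD a h b0 hb, by simp only [smul_eq_mul]; ring⟩
    · exact ⟨_, hD a0 ha b h, by simp only [smul_eq_mul]; ring⟩
  calc volume A + volume B = volume (A' ∪ B') := by
        rw [measure_union₀ mB.nullMeasurableSet hdis, vA, vB]
    _ ≤ volume ((2 : ℝ) • D) := measure_mono hsub
    _ = 2 * volume D := by simp [Measure.addHaar_smul]

/-- One-dimensional Brunn–Minkowski inequality for measurable sets. -/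
lemma volume_add_le_of_measurableSet {A B : Set ℝ} (hA : MeasurableSet A) (hB : MeasurableSet B)
    (hA' : A.Nonempty) (hB' : B.Nonempty) {D : Set ℝ}
    (hD : ∀ a ∈ A, ∀ b ∈ B, (a + b) / 2 ∈ D) :
    volume A + volume B ≤ 2 * volume D := by
  obtain ⟨a, ha⟩ := hA'
  obtain ⟨b, hb⟩ := hB'
  have key : ∀ K ⊆ A, IsCompact K → ∀ K' ⊆ B, IsCompact K' →
      volume K + volume K' ≤ 2 * volume D := by
    intro K hKA hK K' hKB hK'
    calc volume K + volume K' ≤ volume (insert a K) + volume (insert b K') := by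
          gcongr <;> exact Set.subset_insert _ _
      _ ≤ 2 * volume D := by
          refine volume_add_le_of_isCompact (hK.insert a) (hK'.insert b) (Set.insert_nonempty _ _)
            (Set.insert_nonempty _ _) fun x hx y hy => hD x ?_ y ?_
          · exact Set.insert_subset ha hKA hx
          · exact Set.insert_subset hb hKB hy
  rw [hA.measure_eq_iSup_isCompact, hB.measure_eq_iSup_isCompact]
  have e : (⨆ K, ⨆ (_ : K ⊆ A), ⨆ (_ : IsCompact K), volume K)
      = ⨆ p : {K // K ⊆ A ∧ IsCompact K}, volume p.1 := by
    simp only [iSup_subtype, iSup_and]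
  have e' : (⨆ K, ⨆ (_ : K ⊆ B), ⨆ (_ : IsCompact K), volume K)
      = ⨆ p : {K // K ⊆ B ∧ IsCompact K}, volume p.1 := by
    simp only [iSup_subtype, iSup_and]
  have : Nonempty {K // K ⊆ A ∧ IsCompact K} := ⟨⟨∅, by simp⟩⟩
  have : Nonempty {K // K ⊆ B ∧ IsCompact K} := ⟨⟨∅, by simp⟩⟩
  rw [e, e']
  exact ENNReal.iSup_add_iSup_le fun p q => key _ p.2.1 p.2.2 _ q.2.1 q.2.2

/-- Layer-cake form of the one-dimensional Prékopa–Leindler inequality for functions with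
supremum one. -/
lemma lintegral_add_le_of_normalized {f g h : ℝ → ℝ} (hf : Measurable f) (hg : Measurable g)
    (hh : Measurable h) (hf0 : 0 ≤ f) (hg0 : 0 ≤ g) (hh0 : 0 ≤ h)
    (hf1 : ∀ x, f x ≤ 1) (hg1 : ∀ x, g x ≤ 1)
    (hf2 : ∀ t < 1, ∃ x, t < f x) (hg2 : ∀ t < 1, ∃ x, t < g x)
    (hfg : ∀ x y, f x * g y ≤ h ((x + y) / 2) ^ 2) :
    (∫⁻ x, ENNReal.ofReal (f x)) + (∫⁻ x, ENNReal.ofReal (g x))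
      ≤ 2 * ∫⁻ x, ENNReal.ofReal (h x) := by
  have lc : ∀ {k : ℝ → ℝ}, Measurable k → 0 ≤ k →
      ∫⁻ x, ENNReal.ofReal (k x) = ∫⁻ t in Set.Ioi 0, volume {a | t < k a} := fun hk hk0 =>
    lintegral_eq_lintegral_meas_lt _ (Filter.Eventually.of_forall hk0) hk.aemeasurable
  have hm : ∀ k : ℝ → ℝ, Measurable fun t : ℝ => volume {a | t < k a} := fun k =>
    Antitone.measurable fun s t hst => measure_mono fun a (ha : t < k a) => hst.trans_lt ha
  rw [lc hf hf0, lc hg hg0, lc hh hh0, ← lintegral_add_left (hm f), ← lintegral_const_mul _ (hm h)]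
  refine setLIntegral_mono ((hm h).const_mul _) fun t (ht : 0 < t) => ?_
  rcases lt_or_ge t 1 with h1 | h1
  · refine volume_add_le_of_measurableSet (hf measurableSet_Ioi) (hg measurableSet_Ioi)
      (hf2 t h1) (hg2 t h1) fun a ha b hb => ?_
    have ha' : t < f a := ha
    have hb' : t < g b := hb
    refine lt_of_pow_lt_pow_left₀ 2 (hh0 _) (lt_of_lt_of_le ?_ (hfg a b))
    nlinarith
  · have : {a | t < f a} = ∅ := by
      ext a; simpa using (hf1 a).trans h1
    have : {a | t < g a} = ∅ := by
      ext a; simpa using (hg1 a).trans h1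
    simp [*]

lemma ennreal_mul_le_sq_of_add_le {F G I : ENNReal} (key : F + G ≤ 2 * I) : F * G ≤ I ^ 2 := by
  by_cases hI : I = ⊤
  · simp [hI]
  have hFG : F + G ≠ ⊤ := ne_top_of_le_ne_top (ENNReal.mul_ne_top (by simp) hI) key
  obtain ⟨hF, hG⟩ := ENNReal.add_ne_top.1 hFG
  lift F to NNReal using hF
  lift G to NNReal using hG
  lift I to NNReal using hI
  norm_cast at key ⊢
  have key' : (F : ℝ) + G ≤ 2 * I := by exact_mod_cast key
  have : (F : ℝ) * G ≤ I ^ 2 := by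
    nlinarith [sq_nonneg ((F : ℝ) - G), F.coe_nonneg, G.coe_nonneg, I.coe_nonneg]
  exact_mod_cast this

/-- Midpoint Prékopa–Leindler on the line, for functions with finite supremum. -/
lemma lintegral_mul_le_sq_of_bdd {f g : ℝ → ℝ} {h : ℝ → ENNReal} (hf : Measurable f)
    (hg : Measurable g) (hh : Measurable h) (hf0 : 0 ≤ f) (hg0 : 0 ≤ g)
    (hf1 : BddAbove (Set.range f)) (hg1 : BddAbove (Set.range g))
    (hfg : ∀ x y, ENNReal.ofReal (f x) * ENNReal.ofReal (g y) ≤ h ((x + y) / 2) ^ 2) :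
    (∫⁻ x, ENNReal.ofReal (f x)) * (∫⁻ x, ENNReal.ofReal (g x)) ≤ (∫⁻ x, h x) ^ 2 := by
  set M := ⨆ x, f x with hM
  set N := ⨆ x, g x with hN
  have hfM : ∀ x, f x ≤ M := fun x => le_ciSup hf1 x
  have hgN : ∀ x, g x ≤ N := fun x => le_ciSup hg1 x
  rcases le_or_gt M 0 with hM0 | hM0
  · have : ∀ x, ENNReal.ofReal (f x) = 0 := fun x => ENNReal.ofReal_eq_zero.2 ((hfM x).trans hM0)
    simp [this]
  rcases le_or_gt N 0 with hN0 | hN0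
  · have : ∀ x, ENNReal.ofReal (g x) = 0 := fun x => ENNReal.ofReal_eq_zero.2 ((hgN x).trans hN0)
    simp [this]
  set S := √(M * N) with hS
  have hS0 : 0 < S := by positivity
  have hS2 : S ^ 2 = M * N := Real.sq_sqrt (by positivity)
  let k : ℝ → ℝ := fun x => (min (h x) (ENNReal.ofReal S)).toReal / S
  have hk : ∀ x, ENNReal.ofReal S * ENNReal.ofReal (k x) ≤ h x := fun x => by
    rw [← ENNReal.ofReal_mul hS0.le, mul_div_cancel₀ _ hS0.ne', ENNReal.ofReal_toReal]
    · exact min_le_left _ _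
    · exact ne_top_of_le_ne_top ENNReal.ofReal_ne_top (min_le_right _ _)
  have key := lintegral_add_le_of_normalized (f := fun x => f x / M) (g := fun x => g x / N)
    (h := k) (hf.div_const _) (hg.div_const _)
    ((hh.min measurable_const).ennreal_toReal.div_const _)
    (fun x => div_nonneg (hf0 x) hM0.le) (fun x => div_nonneg (hg0 x) hN0.le)
    (fun x => div_nonneg ENNReal.toReal_nonneg hS0.le)
    (fun x => (div_le_one hM0).2 (hfM x)) (fun x => (div_le_one hN0).2 (hgN x))
    (fun t ht => by
      obtain ⟨x, hx⟩ := exists_lt_of_lt_ciSup (show t * M < M by nlinarith)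
      exact ⟨x, (lt_div_iff₀ hM0).2 hx⟩)
    (fun t ht => by
      obtain ⟨x, hx⟩ := exists_lt_of_lt_ciSup (show t * N < N by nlinarith)
      exact ⟨x, (lt_div_iff₀ hN0).2 hx⟩)
    (fun x y => by
      have h1 : f x * g y ≤ (min (h ((x + y) / 2)) (ENNReal.ofReal S)).toReal ^ 2 := by
        rcases le_total (h ((x + y) / 2)) (ENNReal.ofReal S) with hle | hle
        · rw [min_eq_left hle, ← ENNReal.toReal_pow]
          have := ENNReal.toReal_mono (ENNReal.pow_ne_top
            (ne_top_of_le_ne_top ENNReal.ofReal_ne_top hle)) (hfg x y)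
          rwa [ENNReal.toReal_mul, ENNReal.toReal_ofReal (hf0 x),
            ENNReal.toReal_ofReal (hg0 y)] at this
        · rw [min_eq_right hle, ENNReal.toReal_ofReal hS0.le, hS2]
          exact mul_le_mul (hfM x) (hgN y) (hg0 y) hM0.le
      simp only [k]
      rw [div_pow, hS2, div_mul_div_comm]
      gcongr)
  have e1 : ∀ (c : ℝ) (u : ℝ → ℝ), 0 < c → Measurable u → ∫⁻ x, ENNReal.ofReal (u x) =
      ENNReal.ofReal c * ∫⁻ x, ENNReal.ofReal (u x / c) := fun c u hc hu => by
    rw [← lintegral_const_mul _ (hu.div_const _).ennreal_ofReal]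
    congr with x
    rw [← ENNReal.ofReal_mul hc.le, mul_div_cancel₀ _ hc.ne']
  rw [e1 M f hM0 hf, e1 N g hN0 hg]
  set F := ∫⁻ x, ENNReal.ofReal (f x / M)
  set G := ∫⁻ x, ENNReal.ofReal (g x / N)
  have h3 : ENNReal.ofReal S * (∫⁻ x, ENNReal.ofReal (k x)) ≤ ∫⁻ x, h x := by
    rw [← lintegral_const_mul' _ _ ENNReal.ofReal_ne_top]
    exact lintegral_mono hk
  have h4 : F * G ≤ (∫⁻ x, ENNReal.ofReal (k x)) ^ 2 := by
    set I := ∫⁻ x, ENNReal.ofReal (k x)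
    exact ennreal_mul_le_sq_of_add_le key
  calc ENNReal.ofReal M * F * (ENNReal.ofReal N * G)
      = ENNReal.ofReal S ^ 2 * (F * G) := by
        rw [← ENNReal.ofReal_pow hS0.le, hS2, ENNReal.ofReal_mul hM0.le]; ring
    _ ≤ ENNReal.ofReal S ^ 2 * (∫⁻ x, ENNReal.ofReal (k x)) ^ 2 := by gcongr
    _ = (ENNReal.ofReal S * (∫⁻ x, ENNReal.ofReal (k x))) ^ 2 := by ring
    _ ≤ _ := by gcongr

/-- Midpoint Prékopa–Leindler inequality on the line. -/
lemma lintegral_mul_le_sq {f g h : ℝ → ENNReal} (hf : Measurable f) (hg : Measurable g)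
    (hh : Measurable h) (hfg : ∀ x y, f x * g y ≤ h ((x + y) / 2) ^ 2) :
    (∫⁻ x, f x) * (∫⁻ x, g x) ≤ (∫⁻ x, h x) ^ 2 := by
  have htr : ∀ {k : ℝ → ENNReal}, Measurable k →
      ∫⁻ x, k x = ⨆ n : ℕ, ∫⁻ x, min (k x) n := fun {k} hk => by
    rw [← lintegral_iSup (fun n => hk.min measurable_const)
      (fun n m hnm x => min_le_min_left _ (by exact_mod_cast hnm))]
    congr with x
    rw [← inf_iSup_eq, ENNReal.iSup_natCast, inf_top_eq]
  rw [htr hf, htr hg]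
  rw [ENNReal.iSup_mul]
  refine iSup_le fun n => ?_
  rw [ENNReal.mul_iSup]
  refine iSup_le fun m => ?_
  have tr : ∀ (k : ℝ → ENNReal) (n : ℕ) x, ENNReal.ofReal (min (k x) n).toReal = min (k x) n :=
    fun k n x => ENNReal.ofReal_toReal
      (ne_top_of_le_ne_top (ENNReal.natCast_ne_top n) (min_le_right _ _))
  have bd : ∀ (k : ℝ → ENNReal) (n : ℕ), BddAbove (Set.range fun x => (min (k x) n).toReal) :=
    fun k n => ⟨n, by
      rintro _ ⟨x, rfl⟩
      exact ENNReal.toReal_mono (ENNReal.natCast_ne_top n) (min_le_right _ _)⟩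
  have := lintegral_mul_le_sq_of_bdd (f := fun x => (min (f x) n).toReal)
    (g := fun x => (min (g x) m).toReal) (h := h)
    (hf.min measurable_const).ennreal_toReal (hg.min measurable_const).ennreal_toReal hh
    (fun _ => ENNReal.toReal_nonneg) (fun _ => ENNReal.toReal_nonneg) (bd f n) (bd g m)
    (fun x y => by
      rw [tr, tr]
      exact (mul_le_mul' (min_le_left _ _) (min_le_left _ _)).trans (hfg x y))
  simpa only [tr] using this

/-- Multiplicative midpoint Brunn–Minkowski inequality in `Fin n → ℝ`. -/
lemma volume_pi_mul_le_sq (n : ℕ) : ∀ {A B D : Set (Fin n → ℝ)}, MeasurableSet A →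
    MeasurableSet B → MeasurableSet D → (∀ a ∈ A, ∀ b ∈ B, (2⁻¹ : ℝ) • (a + b) ∈ D) →
    volume A * volume B ≤ volume D ^ 2 := by
  induction n with
  | zero =>
    intro A B D hA hB hD h
    rcases A.eq_empty_or_nonempty with rfl | ⟨a, ha⟩
    · simp
    rcases B.eq_empty_or_nonempty with rfl | ⟨b, hb⟩
    · simp
    have hU : ∀ S : Set (Fin 0 → ℝ), S.Nonempty → S = Set.univ := fun S hS =>
      Subsingleton.eq_univ_of_nonempty hS
    rw [hU A ⟨a, ha⟩, hU B ⟨b, hb⟩, hU D ⟨_, h a ha b hb⟩, sq]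
  | succ n ih =>
    intro A B D hA hB hD h
    let e := (MeasurableEquiv.piFinSuccAbove (fun _ : Fin (n + 1) => ℝ) 0).symm
    have he : MeasurePreserving e :=
      (volume_preserving_piFinSuccAbove (fun _ : Fin (n + 1) => ℝ) 0).symm _
    have hv : ∀ {S : Set (Fin (n + 1) → ℝ)}, MeasurableSet S →
        volume S = ∫⁻ x : ℝ, volume (Prod.mk x ⁻¹' (e ⁻¹' S)) := fun {S} hS => by
      rw [← he.measure_preimage hS.nullMeasurableSet]
      exact Measure.prod_apply (e.measurable hS)
    have hm : ∀ {S : Set (Fin (n + 1) → ℝ)}, MeasurableSet S →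
        Measurable fun x : ℝ => volume (Prod.mk x ⁻¹' (e ⁻¹' S)) := fun {S} hS =>
      measurable_measure_prodMk_left (e.measurable hS)
    rw [hv hA, hv hB, hv hD]
    refine lintegral_mul_le_sq (hm hA) (hm hB) (hm hD) fun x y => ?_
    refine ih (measurable_prodMk_left (e.measurable hA)) (measurable_prodMk_left (e.measurable hB))
      (measurable_prodMk_left (e.measurable hD)) fun a ha b hb => ?_
    have := h _ ha _ hb
    simp only [Set.mem_preimage]
    convert this using 1
    ext i
    refine Fin.cases ?_ (fun j => ?_) i
    · simp [e, MeasurableEquiv.piFinSuccAbove]; ring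
    · simp [e, MeasurableEquiv.piFinSuccAbove]; ring

/-- Multiplicative midpoint Brunn–Minkowski inequality in Euclidean space. -/
lemma volume_euclidean_mul_le_sq {n : ℕ} {A B D : Set (EuclideanSpace ℝ (Fin n))}
    (hA : MeasurableSet A) (hB : MeasurableSet B) (hD : MeasurableSet D)
    (h : ∀ a ∈ A, ∀ b ∈ B, (2⁻¹ : ℝ) • (a + b) ∈ D) :
    volume A * volume B ≤ volume D ^ 2 := by
  have he := PiLp.volume_preserving_toLp (Fin n)
  rw [← he.measure_preimage hA.nullMeasurableSet, ← he.measure_preimage hB.nullMeasurableSet,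
    ← he.measure_preimage hD.nullMeasurableSet]
  exact volume_pi_mul_le_sq n (he.measurable hA) (he.measurable hB) (he.measurable hD)
    fun a ha b hb => h _ ha _ hb

section Marginals

variable {n : ℕ} {C : Set (EuclideanSpace ℝ (Fin n))} {θ : EuclideanSpace ℝ (Fin n)} {σ : ℝ}

lemma integrableOn_of_continuous_of_isCompact {F : Type*} [NormedAddCommGroup F]
    (hC : IsCompact C) {f : EuclideanSpace ℝ (Fin n) → F} (hf : Continuous f) :
    IntegrableOn f C := hf.continuousOn.integrableOn_compact hC

/-- Midpoint log-concavity of the tails of a marginal of a convex body. -/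
lemma tail_mul_tail_le_sq (hC : Convex ℝ C) (hCc : IsCompact C) (u v : ℝ) :
    volume.real (C ∩ {x | u ≤ ⟪x, θ⟫}) * volume.real (C ∩ {x | v ≤ ⟪x, θ⟫})
      ≤ volume.real (C ∩ {x | (u + v) / 2 ≤ ⟪x, θ⟫}) ^ 2 := by
  have hm : ∀ w : ℝ, MeasurableSet (C ∩ {x | w ≤ ⟪x, θ⟫}) := fun w =>
    hCc.measurableSet.inter (measurableSet_le measurable_const (by fun_prop))
  have hfin : ∀ w : ℝ, volume (C ∩ {x | w ≤ ⟪x, θ⟫}) ≠ ⊤ := fun w =>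
    ne_top_of_le_ne_top hCc.measure_lt_top.ne (measure_mono Set.inter_subset_left)
  have := volume_euclidean_mul_le_sq (hm u) (hm v) (hm ((u + v) / 2)) fun a ha b hb => by
    refine ⟨?_, ?_⟩
    · have := hC ha.1 hb.1 (a := 2⁻¹) (b := 2⁻¹) (by norm_num) (by norm_num) (by norm_num)
      rwa [← smul_add] at this
    · have h1 : u ≤ ⟪a, θ⟫ := ha.2
      have h2 : v ≤ ⟪b, θ⟫ := hb.2
      simp only [Set.mem_ofPred_eq, inner_smul_left, inner_add_left]
      simp
      linarith
  have := ENNReal.toReal_mono (ENNReal.pow_ne_top (hfin _)) this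
  simpa [ENNReal.toReal_mul, ENNReal.toReal_pow, measureReal_def] using this

/-- Exponential decay of the tails of a marginal of a convex body at dyadic levels. -/
lemma tail_dyadic_le (hC : Convex ℝ C) (hCc : IsCompact C) (hvol : volume C = 1) (hσ : 0 < σ)
    (h2 : ∫ x in C, ⟪x, θ⟫ ^ 2 ≤ σ ^ 2) (k : ℕ) :
    volume.real (C ∩ {x | 4 * σ * 2 ^ k - 2 * σ ≤ ⟪x, θ⟫}) ≤ (1 / 3) ^ (2 ^ k) := by
  have hvr : volume.real C = 1 := by simp [measureReal_def, hvol]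
  have hm : ∀ w : ℝ, MeasurableSet {x : EuclideanSpace ℝ (Fin n) | w ≤ ⟪x, θ⟫} := fun w =>
    measurableSet_le measurable_const (by fun_prop)
  let G : ℝ → ℝ := fun w => volume.real (C ∩ {x | w - 2 * σ ≤ ⟪x, θ⟫})
  have hch : volume.real (C ∩ {x | 4 * σ ^ 2 ≤ ⟪x, θ⟫ ^ 2}) ≤ 1 / 4 := by
    have := mul_meas_ge_le_integral_of_nonneg (μ := volume.restrict C)
      (f := fun x => ⟪x, θ⟫ ^ 2) (Filter.Eventually.of_forall fun x => sq_nonneg _)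
      (integrableOn_of_continuous_of_isCompact hCc (by fun_prop)) (4 * σ ^ 2)
    rw [measureReal_restrict_apply (measurableSet_le measurable_const (by fun_prop)),
      Set.inter_comm] at this
    have h4 : 0 < σ ^ 2 := by positivity
    by_contra! hcon
    nlinarith
  have hfin : ∀ S : Set (EuclideanSpace ℝ (Fin n)), volume (C ∩ S) ≠ ⊤ := fun S =>
    ne_top_of_le_ne_top hCc.measure_lt_top.ne (measure_mono Set.inter_subset_left)
  have hG0 : 3 / 4 ≤ G 0 := by
    have hsub : C ⊆ (C ∩ {x | 0 - 2 * σ ≤ ⟪x, θ⟫}) ∪ (C ∩ {x | 4 * σ ^ 2 ≤ ⟪x, θ⟫ ^ 2}) := by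
      intro x hx
      by_cases hx' : 0 - 2 * σ ≤ ⟪x, θ⟫
      · exact Or.inl ⟨hx, hx'⟩
      · refine Or.inr ⟨hx, ?_⟩
        simp only [Set.mem_ofPred_eq]
        nlinarith
    have := (measureReal_mono hsub (measure_union_lt_top (hfin _).lt_top (hfin _).lt_top).ne).trans
      (measureReal_union_le _ _)
    rw [hvr] at this
    simp only [G]
    linarith
  have hG1 : G (4 * σ) ≤ 1 / 4 := by
    refine le_trans (measureReal_mono ?_ (hfin _)) hch
    rintro x ⟨hx, hx'⟩
    refine ⟨hx, ?_⟩
    simp only [Set.mem_ofPred_eq] at *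
    nlinarith
  have hdbl : ∀ w, G (2 * w) * G 0 ≤ G w ^ 2 := fun w => by
    have := tail_mul_tail_le_sq (θ := θ) hC hCc (2 * w - 2 * σ) (0 - 2 * σ)
    rw [show (2 * w - 2 * σ + (0 - 2 * σ)) / 2 = w - 2 * σ by ring] at this
    exact this
  have hGn : ∀ w, 0 ≤ G w := fun w => measureReal_nonneg
  have hG0' : G 0 ≤ 1 := hvr ▸ measureReal_mono Set.inter_subset_left hCc.measure_lt_top.ne
  have main : ∀ k : ℕ, G (4 * σ * 2 ^ k) ≤ (1 / 3) ^ (2 ^ k) * G 0 := by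
    intro k
    induction k with
    | zero => simp only [pow_zero, mul_one, pow_one]; linarith
    | succ k ih =>
      have h := hdbl (4 * σ * 2 ^ k)
      have e : 2 * (4 * σ * 2 ^ k) = 4 * σ * 2 ^ (k + 1) := by ring
      rw [e] at h
      have h3 : G (4 * σ * 2 ^ k) ^ 2 ≤ ((1 / 3) ^ (2 ^ k) * G 0) ^ 2 :=
        pow_le_pow_left₀ (hGn _) ih 2
      have e3 : ((1 / 3 : ℝ) ^ (2 ^ k) * G 0) ^ 2 = ((1 / 3) ^ (2 ^ (k + 1)) * G 0) * G 0 := by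
        rw [mul_pow, ← pow_mul, ← pow_succ]; ring
      exact le_of_mul_le_mul_right ((h.trans h3).trans_eq e3) (by linarith)
  exact (main k).trans (mul_le_of_le_one_right (by positivity) hG0')

lemma exp_eighth_le : Real.exp (1 / 8) ≤ 3 / 2 := by
  have h := Real.exp_one_lt_d9
  have : Real.exp (1 / 8) ^ 8 = Real.exp 1 := by rw [← Real.exp_nat_mul]; norm_num
  by_contra! hcon
  have := pow_le_pow_left₀ (by norm_num) hcon.le 8
  norm_num at this
  linarith

lemma exp_half_div_three_le : Real.exp (1 / 2) * (1 / 3) ≤ 3 / 5 := by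
  have h := Real.exp_one_lt_d9
  have : Real.exp (1 / 2) ^ 2 = Real.exp 1 := by rw [← Real.exp_nat_mul]; norm_num
  by_contra! hcon
  nlinarith

/-- Exponential integrability of marginals of a convex body. -/
lemma integral_exp_marginal_le (hC : Convex ℝ C) (hCc : IsCompact C) (hvol : volume C = 1)
    (hσ : 0 < σ) (h2 : ∫ x in C, ⟪x, θ⟫ ^ 2 ≤ σ ^ 2) :
    ∫ x in C, Real.exp (⟪x, θ⟫ / (16 * σ)) ≤ 3 := by
  have hm : ∀ w : ℝ, MeasurableSet {x : EuclideanSpace ℝ (Fin n) | w ≤ ⟪x, θ⟫} := fun w =>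
    measurableSet_le measurable_const (by fun_prop)
  let S : ℕ → Set (EuclideanSpace ℝ (Fin n)) := fun k => {x | 4 * σ * 2 ^ k - 2 * σ ≤ ⟪x, θ⟫}
  have hpt : ∀ x : EuclideanSpace ℝ (Fin n), ENNReal.ofReal (Real.exp (⟪x, θ⟫ / (16 * σ))) ≤
      ENNReal.ofReal (3 / 2) +
        ∑' k, (S k).indicator (fun _ => ENNReal.ofReal (Real.exp (1 / 2) ^ (2 ^ k))) x := by
    intro x
    rcases lt_or_ge ⟪x, θ⟫ (2 * σ) with h | h
    · refine le_trans (ENNReal.ofReal_le_ofReal (le_trans (Real.exp_le_exp.2 ?_) exp_eighth_le))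
        le_self_add
      rw [div_le_div_iff₀ (by positivity) (by norm_num)]
      linarith
    · obtain ⟨k, hk1, hk2⟩ := exists_nat_pow_near (x := (⟪x, θ⟫ + 2 * σ) / (4 * σ)) (y := 2)
        (by rw [le_div_iff₀ (by positivity)]; linarith) (by norm_num)
      rw [le_div_iff₀ (by positivity)] at hk1
      rw [div_lt_iff₀ (by positivity)] at hk2
      refine le_trans ?_ le_add_self
      refine le_trans ?_ (ENNReal.le_tsum k)
      rw [Set.indicator_of_mem (show x ∈ S k by simp only [S, Set.mem_ofPred_eq]; linarith)]
      refine ENNReal.ofReal_le_ofReal ?_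
      rw [← Real.exp_nat_mul, Real.exp_le_exp, div_le_iff₀ (by positivity)]
      push_cast
      rw [pow_succ] at hk2
      nlinarith
  have hlin : ∫⁻ x in C, ENNReal.ofReal (Real.exp (⟪x, θ⟫ / (16 * σ))) ≤ ENNReal.ofReal 3 := by
    calc _ ≤ ∫⁻ x in C, (ENNReal.ofReal (3 / 2) +
        ∑' k, (S k).indicator (fun _ => ENNReal.ofReal (Real.exp (1 / 2) ^ (2 ^ k))) x) :=
          lintegral_mono hpt
      _ = ENNReal.ofReal (3 / 2) +
          ∑' k, ENNReal.ofReal (Real.exp (1 / 2) ^ (2 ^ k)) * volume (C ∩ S k) := by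
          rw [lintegral_add_left measurable_const, lintegral_tsum]
          · simp only [lintegral_const, Measure.restrict_apply_univ, hvol, mul_one]
            congr with k
            rw [lintegral_indicator (hm _), setLIntegral_const, Measure.restrict_apply (hm _),
              Set.inter_comm]
          · exact fun k => (measurable_const.indicator (hm _)).aemeasurable
      _ ≤ ENNReal.ofReal (3 / 2) + ∑' k : ℕ, ENNReal.ofReal ((3 / 5) ^ (k + 1)) := by
          gcongr with k
          have hfin : volume (C ∩ S k) ≠ ⊤ :=
            ne_top_of_le_ne_top hCc.measure_lt_top.ne (measure_mono Set.inter_subset_left)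
          rw [← ENNReal.ofReal_toReal hfin, ← ENNReal.ofReal_mul (by positivity)]
          refine ENNReal.ofReal_le_ofReal ?_
          calc Real.exp (1 / 2) ^ (2 ^ k) * (volume (C ∩ S k)).toReal
              ≤ Real.exp (1 / 2) ^ (2 ^ k) * (1 / 3) ^ (2 ^ k) := by
                gcongr
                exact tail_dyadic_le hC hCc hvol hσ h2 k
            _ = (Real.exp (1 / 2) * (1 / 3)) ^ (2 ^ k) := (mul_pow _ _ _).symm
            _ ≤ (3 / 5) ^ (2 ^ k) := by gcongr; exact exp_half_div_three_le
            _ ≤ (3 / 5) ^ (k + 1) :=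
                pow_le_pow_of_le_one (by norm_num) (by norm_num) (Nat.lt_two_pow_self)
      _ = ENNReal.ofReal (3 / 2) + ENNReal.ofReal (3 / 2) := by
          congr 1
          have hs : HasSum (fun k : ℕ => (3 / 5 : ℝ) ^ (k + 1)) (3 / 2) := by
            have := (hasSum_geometric_of_lt_one (r := (3 / 5 : ℝ)) (by norm_num)
              (by norm_num)).mul_left (3 / 5)
            have e : (3 / 5 : ℝ) * (1 - 3 / 5)⁻¹ = 3 / 2 := by norm_num
            rw [e] at this
            simpa only [pow_succ'] using this
          rw [← ENNReal.ofReal_tsum_of_nonneg (fun _ => by positivity) hs.summable, hs.tsum_eq]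
      _ = ENNReal.ofReal 3 := by rw [← ENNReal.ofReal_add] <;> norm_num
  rw [integral_eq_lintegral_of_nonneg_ae (Filter.Eventually.of_forall fun x => (Real.exp_pos _).le)
    (by fun_prop)]
  exact ENNReal.toReal_le_of_le_ofReal (by norm_num) hlin

lemma exp_le_quadratic {z a u : ℝ} (ha : 0 < a) (hu : |u| ≤ a / 2) :
    Real.exp (u * z) ≤ 1 + u * z + 4 * (u / a) ^ 2 * (Real.exp (a * z) + Real.exp (a * -z)) := by
  have h1 : Real.exp (u * z) ≤ 1 + u * z + (u * z) ^ 2 * Real.exp |u * z| := by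
    set v := u * z
    have hv : Real.exp v - 1 ≤ v * Real.exp v := by
      have h := mul_le_mul_of_nonneg_right (Real.add_one_le_exp (-v)) (Real.exp_pos v).le
      rw [← Real.exp_add, neg_add_cancel, Real.exp_zero] at h
      linarith
    rcases le_total 0 v with h0 | h0
    · rw [abs_of_nonneg h0]
      nlinarith [mul_le_mul_of_nonneg_left hv h0]
    · have h2 : 1 ≤ Real.exp |v| := Real.one_le_exp (abs_nonneg _)
      have h3 : v + 1 ≤ Real.exp v := Real.add_one_le_exp v
      nlinarith [mul_le_mul_of_nonneg_left h2 (sq_nonneg v),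
        mul_le_mul_of_nonneg_left h3 (neg_nonneg.2 h0)]
  set s := a * |z| with hs
  have hs0 : 0 ≤ s := by positivity
  have h2 : |u * z| ≤ s / 2 := by
    rw [abs_mul, hs]
    nlinarith [abs_nonneg z]
  have h3 : (u * z) ^ 2 = (u / a) ^ 2 * s ^ 2 := by
    rw [hs, mul_pow a, sq_abs]; field_simp
  have h4 : s ^ 2 ≤ 4 * Real.exp (s / 2) := by
    have h5 : s ≤ 2 * Real.exp (s / 4) := by
      nlinarith [Real.quadratic_le_exp_of_nonneg (show 0 ≤ s / 4 by positivity),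
        sq_nonneg (s / 4 - 1)]
    have h6 : Real.exp (s / 2) = Real.exp (s / 4) ^ 2 := by
      rw [← Real.exp_nat_mul]; congr 1; push_cast; ring
    rw [h6]
    nlinarith
  have h7 : Real.exp s ≤ Real.exp (a * z) + Real.exp (a * -z) := by
    rcases le_total 0 z with h0 | h0
    · rw [hs, abs_of_nonneg h0]; linarith [Real.exp_pos (a * -z)]
    · rw [hs, abs_of_nonpos h0]; linarith [Real.exp_pos (a * z)]
  have h8 : Real.exp |u * z| ≤ Real.exp (s / 2) := Real.exp_le_exp.2 h2
  calc Real.exp (u * z) ≤ 1 + u * z + (u * z) ^ 2 * Real.exp |u * z| := h1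
    _ ≤ 1 + u * z + ((u / a) ^ 2 * (4 * Real.exp (s / 2))) * Real.exp (s / 2) := by
        rw [h3]; gcongr
    _ = 1 + u * z + 4 * (u / a) ^ 2 * Real.exp s := by
        have : Real.exp s = Real.exp (s / 2) * Real.exp (s / 2) := by
          rw [← Real.exp_add, add_halves]
        rw [this]; ring
    _ ≤ _ := by gcongr

/-- Sub-gaussian bound, near zero, on the moment generating function of a centred marginal of a
convex body. -/
lemma integral_exp_mul_marginal_le (hC : Convex ℝ C) (hCc : IsCompact C) (hvol : volume C = 1)
    (hσ : 0 < σ) (h1 : ∫ x in C, ⟪x, θ⟫ = 0) (h2 : ∫ x in C, ⟪x, θ⟫ ^ 2 ≤ σ ^ 2)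
    {u : ℝ} (hu : |u| ≤ 1 / (32 * σ)) :
    ∫ x in C, Real.exp (u * ⟪x, θ⟫) ≤ Real.exp (6144 * σ ^ 2 * u ^ 2) := by
  have hI : ∀ {f : EuclideanSpace ℝ (Fin n) → ℝ}, Continuous f → Integrable f (volume.restrict C) :=
    fun hf => integrableOn_of_continuous_of_isCompact hCc hf
  have hp := integral_exp_marginal_le hC hCc hvol hσ h2
  have hn := integral_exp_marginal_le (θ := -θ) hC hCc hvol hσ (by simpa using h2)
  have hvr : volume.real C = 1 := by simp [measureReal_def, hvol]
  set a := 1 / (16 * σ) with ha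
  have ha0 : 0 < a := by positivity
  calc ∫ x in C, Real.exp (u * ⟪x, θ⟫)
      ≤ ∫ x in C, (1 + u * ⟪x, θ⟫ + 4 * (u / a) ^ 2 *
          (Real.exp (⟪x, θ⟫ / (16 * σ)) + Real.exp (⟪x, -θ⟫ / (16 * σ)))) := by
        refine integral_mono (hI (by fun_prop)) (hI (by fun_prop)) fun x => ?_
        have := exp_le_quadratic (z := ⟪x, θ⟫) ha0 (u := u)
          (hu.trans_eq (by rw [ha]; field_simp; norm_num))
        simpa [ha, inner_neg_right, div_eq_inv_mul] using this
    _ = 1 + 4 * (u / a) ^ 2 * ((∫ x in C, Real.exp (⟪x, θ⟫ / (16 * σ))) +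
          ∫ x in C, Real.exp (⟪x, -θ⟫ / (16 * σ))) := by
        rw [integral_add (hI (by fun_prop)) (hI (by fun_prop)),
          integral_add (hI (by fun_prop)) (hI (by fun_prop)), integral_const_mul,
          integral_const_mul, h1, integral_add (hI (by fun_prop)) (hI (by fun_prop))]
        simp [hvr]
    _ ≤ 1 + 4 * (u / a) ^ 2 * (3 + 3) := by gcongr
    _ = 6144 * σ ^ 2 * u ^ 2 + 1 := by rw [ha]; field_simp; ring
    _ ≤ _ := Real.add_one_le_exp _

end Marginals

/-- The moment generating function of a weighted sum of independent vectors uniformly distributed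
in an isotropic convex body is bounded near the origin. -/
lemma integral_exp_weighted_sum_le {n s : ℕ} {C : Set (EuclideanSpace ℝ (Fin n))}
    (hC : IsConvexBody C) {L : ℝ} (hiso : IsIsotropic C L) (t : Fin s → ℝ) {l : ℝ}
    (hl : |l| * (L * euclNorm t) ≤ 1 / 100) {θ : EuclideanSpace ℝ (Fin n)} (hθ : ‖θ‖ ≤ 1) :
    ∫ x in Set.univ.pi fun _ : Fin s => C, Real.exp (l * ⟪∑ j, t j • x j, θ⟫) ≤ 2 := by
  obtain ⟨hCx, hCc, -⟩ := hC
  obtain ⟨hvol, hbar, hL, h2⟩ := hiso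
  have hmean : ∫ x in C, ⟪x, θ⟫ = 0 := by
    have := integral_inner (𝕜 := ℝ) (μ := volume.restrict C) (f := fun x => x)
      (integrableOn_of_continuous_of_isCompact hCc continuous_id) θ
    simp_rw [real_inner_comm θ]
    rw [this, hbar, inner_zero_right]
  have hvar : ∫ x in C, ⟪x, θ⟫ ^ 2 ≤ L ^ 2 := by
    rcases eq_or_ne θ 0 with rfl | h0
    · simpa using sq_nonneg L
    · have h0' : 0 < ‖θ‖ := norm_pos_iff.2 h0
      have := h2 (‖θ‖⁻¹ • θ) (by rw [norm_smul, norm_inv, norm_norm, inv_mul_cancel₀ h0'.ne'])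
      calc ∫ x in C, ⟪x, θ⟫ ^ 2 = ‖θ‖ ^ 2 * ∫ x in C, ⟪x, ‖θ‖⁻¹ • θ⟫ ^ 2 := by
            rw [← integral_const_mul]
            congr with x
            rw [inner_smul_right]
            field_simp
        _ = ‖θ‖ ^ 2 * L ^ 2 := by rw [this]
        _ ≤ L ^ 2 := mul_le_of_le_one_left (sq_nonneg L) (pow_le_one₀ h0'.le hθ)
  have htj : ∀ j, |t j| ≤ euclNorm t := fun j =>
    Real.abs_le_sqrt (Finset.single_le_sum (f := fun j => t j ^ 2) (fun _ _ => sq_nonneg _)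
      (Finset.mem_univ j))
  have hprod : (volume : Measure (Fin s → EuclideanSpace ℝ (Fin n))).restrict
      (Set.univ.pi fun _ => C) = Measure.pi fun _ => volume.restrict C := by
    rw [volume_pi, Measure.restrict_pi_pi]
  rw [hprod]
  calc ∫ x, Real.exp (l * ⟪∑ j, t j • x j, θ⟫) ∂(Measure.pi fun _ : Fin s => volume.restrict C)
      = ∫ x, ∏ j, Real.exp (l * t j * ⟪x j, θ⟫)
          ∂(Measure.pi fun _ : Fin s => volume.restrict C) := by
        congr with x
        rw [← Real.exp_sum, sum_inner, Finset.mul_sum]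
        congr 1
        refine Finset.sum_congr rfl fun j _ => ?_
        rw [real_inner_smul_left, mul_assoc]
    _ = ∏ j, ∫ y in C, Real.exp (l * t j * ⟪y, θ⟫) :=
        integral_fintype_prod_eq_prod (fun j y => Real.exp (l * t j * ⟪y, θ⟫))
    _ ≤ ∏ j, Real.exp (6144 * L ^ 2 * (l * t j) ^ 2) := by
        refine Finset.prod_le_prod (fun j _ => integral_nonneg fun _ => (Real.exp_pos _).le)
          fun j _ => integral_exp_mul_marginal_le hCx hCc hvol hL hmean hvar ?_
        rw [le_div_iff₀ (by positivity), abs_mul]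
        have := mul_le_mul_of_nonneg_left (htj j) (mul_nonneg (abs_nonneg l) hL.le)
        nlinarith
    _ = Real.exp (6144 * (|l| * (L * euclNorm t)) ^ 2) := by
        rw [← Real.exp_sum, ← Finset.mul_sum]
        simp_rw [mul_pow]
        rw [← Finset.mul_sum, sq_abs, euclNorm,
          Real.sq_sqrt (Finset.sum_nonneg fun _ _ => sq_nonneg _)]
        congr 1; ring
    _ ≤ Real.exp (Real.log 2) := by
        refine Real.exp_le_exp.2 ?_
        have h3 : (|l| * (L * euclNorm t)) ^ 2 ≤ (1 / 100) ^ 2 :=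
          pow_le_pow_left₀ (by unfold euclNorm; positivity) hl 2
        have := Real.log_two_gt_d9
        norm_num at h3 ⊢
        linarith
    _ = 2 := Real.exp_log (by norm_num)

/-- The unnormalised standard Gaussian density. -/
def gaussWeight {n : ℕ} (x : EuclideanSpace ℝ (Fin n)) : ℝ := Real.exp (-(1 / 2) * ‖x‖ ^ 2)

section Gauss

variable {n : ℕ}

lemma gaussWeight_pos (x : EuclideanSpace ℝ (Fin n)) : 0 < gaussWeight x := Real.exp_pos _

lemma continuous_gaussWeight : Continuous (gaussWeight (n := n)) := by
  unfold gaussWeight; fun_prop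

lemma integrable_norm_pow_mul_gaussWeight [Nonempty (Fin n)] (k : ℕ) :
    Integrable fun x : EuclideanSpace ℝ (Fin n) => ‖x‖ ^ k * gaussWeight x := by
  have := (integrable_fun_norm_addHaar (volume : Measure (EuclideanSpace ℝ (Fin n)))
    (f := fun r : ℝ => r ^ k * Real.exp (-(1 / 2) * r ^ 2))).2 ?_
  · exact this
  · refine (integrableOn_rpow_mul_exp_neg_mul_sq (b := 1 / 2) (by norm_num)
      (s := (n - 1 + k : ℕ)) (by linarith [Nat.cast_nonneg (α := ℝ) (n - 1 + k)])).congr_fun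
      (fun r hr => ?_) measurableSet_Ioi
    simp only [finrank_euclideanSpace, Fintype.card_fin, smul_eq_mul, Real.rpow_natCast]
    rw [pow_add]; ring

lemma integrable_gaussWeight [Nonempty (Fin n)] : Integrable (gaussWeight (n := n)) := by
  simpa using integrable_norm_pow_mul_gaussWeight (n := n) 0

lemma integral_gaussWeight_pos [Nonempty (Fin n)] :
    0 < ∫ x : EuclideanSpace ℝ (Fin n), gaussWeight x :=
  integral_pos_of_integrable_nonneg_nonzero (x := 0) continuous_gaussWeight integrable_gaussWeight
    (fun _ => (gaussWeight_pos _).le) (gaussWeight_pos _).ne'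

lemma integral_sq_norm_mul_gaussWeight [Nonempty (Fin n)] :
    ∫ x : EuclideanSpace ℝ (Fin n), ‖x‖ ^ 2 * gaussWeight x
      = n * ∫ x : EuclideanSpace ℝ (Fin n), gaussWeight x := by
  have hn : 0 < n := Fin.pos_iff_nonempty.2 inferInstance
  have e : ∀ k : ℕ, ∫ x : EuclideanSpace ℝ (Fin n), ‖x‖ ^ k * gaussWeight x =
      n • volume.real (Metric.ball (0 : EuclideanSpace ℝ (Fin n)) 1) •
        ((1 / 2 : ℝ) ^ (-(((n - 1 + k : ℕ) : ℝ) + 1) / 2) * (1 / 2) *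
          Real.Gamma ((((n - 1 + k : ℕ) : ℝ) + 1) / 2)) := by
    intro k
    have h := integral_fun_norm_addHaar (volume : Measure (EuclideanSpace ℝ (Fin n)))
      (fun r : ℝ => r ^ k * Real.exp (-(1 / 2) * r ^ 2))
    rw [finrank_euclideanSpace, Fintype.card_fin] at h
    rw [← integral_rpow_mul_exp_neg_mul_rpow (by norm_num)
      (by linarith [Nat.cast_nonneg (α := ℝ) (n - 1 + k)]) (by norm_num)]
    refine h.trans ?_
    congr 2
    refine setIntegral_congr_fun measurableSet_Ioi fun r hr => ?_
    simp only [smul_eq_mul, Real.rpow_natCast]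
    rw [pow_add, ← Real.rpow_natCast r 2]
    push_cast
    ring
  have e2 := e 2
  have e0 := e 0
  simp only [pow_zero, one_mul] at e0
  rw [e2, e0]
  have c0 : ((n - 1 + 0 : ℕ) : ℝ) + 1 = n := by
    rw [add_zero]; exact_mod_cast Nat.sub_add_cancel hn
  have c2 : ((n - 1 + 2 : ℕ) : ℝ) + 1 = n + 2 := by
    push_cast [Nat.cast_sub (show 1 ≤ n from hn)]; ring
  rw [c0, c2]
  have g : Real.Gamma (((n : ℝ) + 2) / 2) = n / 2 * Real.Gamma (n / 2) := by
    rw [← Real.Gamma_add_one (by positivity)]; congr 1; ring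
  have p : (1 / 2 : ℝ) ^ (-((n : ℝ) + 2) / 2) = 2 * (1 / 2 : ℝ) ^ (-(n : ℝ) / 2) := by
    rw [show -((n : ℝ) + 2) / 2 = -(n : ℝ) / 2 + (-1) by ring, Real.rpow_add (by norm_num),
      Real.rpow_neg_one]
    ring
  rw [g, p]
  simp only [nsmul_eq_mul, smul_eq_mul]
  ring

lemma integral_norm_mul_gaussWeight_le [Nonempty (Fin n)] :
    ∫ x : EuclideanSpace ℝ (Fin n), ‖x‖ * gaussWeight x
      ≤ √n * ∫ x : EuclideanSpace ℝ (Fin n), gaussWeight x := by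
  have hn : 0 < n := Fin.pos_iff_nonempty.2 inferInstance
  have hn' : 0 < √(n : ℝ) := by positivity
  have i1 := integrable_norm_pow_mul_gaussWeight (n := n) 1
  have i2 := integrable_norm_pow_mul_gaussWeight (n := n) 2
  simp only [pow_one] at i1
  calc ∫ x : EuclideanSpace ℝ (Fin n), ‖x‖ * gaussWeight x
      ≤ ∫ x : EuclideanSpace ℝ (Fin n),
          ((2 * √n)⁻¹ * (‖x‖ ^ 2 * gaussWeight x) + √n / 2 * gaussWeight x) := by
        refine integral_mono i1 ((i2.const_mul _).add (integrable_gaussWeight.const_mul _))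
          fun x => ?_
        have : ‖x‖ ≤ (2 * √n)⁻¹ * ‖x‖ ^ 2 + √n / 2 := by
          rw [← sub_nonneg]
          have : (2 * √n)⁻¹ * ‖x‖ ^ 2 + √n / 2 - ‖x‖ = (2 * √n)⁻¹ * (‖x‖ - √n) ^ 2 := by
            field_simp; ring
          rw [this]; positivity
        have := mul_le_mul_of_nonneg_right this (gaussWeight_pos x).le
        simp only
        linarith
    _ = √n * ∫ x : EuclideanSpace ℝ (Fin n), gaussWeight x := by
        rw [integral_add (i2.const_mul _) (integrable_gaussWeight.const_mul _), integral_const_mul,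
          integral_const_mul, integral_sq_norm_mul_gaussWeight]
        have : (n : ℝ) = √n * √n := (Real.mul_self_sqrt (by positivity)).symm
        field_simp
        nth_rewrite 1 [this]
        ring

/-- Polar integration of a positively homogeneous function against a radial one. -/
lemma integral_homogeneous_mul_radial [Nonempty (Fin n)] (f : EuclideanSpace ℝ (Fin n) → ℝ)
    (hf : ∀ (r : ℝ) x, 0 < r → f (r • x) = r * f x) (φ : ℝ → ℝ) :
    ∫ x, f x * φ ‖x‖ = (∫ ξ, f ξ ∂((volume : Measure (EuclideanSpace ℝ (Fin n))).toSphere)) *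
      ∫ r : Set.Ioi (0 : ℝ), r * φ r ∂(Measure.volumeIoiPow (n - 1)) := by
  let μ : Measure (EuclideanSpace ℝ (Fin n)) := volume
  calc ∫ x, f x * φ ‖x‖
      = ∫ x : ({(0)}ᶜ : Set (EuclideanSpace ℝ (Fin n))), f x * φ ‖x.1‖ ∂(μ.comap (↑)) := by
        rw [integral_subtype_comap (measurableSet_singleton _).compl fun x => f x * φ ‖x‖,
          restrict_compl_singleton]
    _ = ∫ p, f p.1 * (p.2 * φ p.2) ∂μ.toSphere.prod (.volumeIoiPow (n - 1)) := by
        have h := μ.measurePreserving_homeomorphUnitSphereProd.integral_comp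
          (Homeomorph.measurableEmbedding _)
          (fun p : Metric.sphere (0 : EuclideanSpace ℝ (Fin n)) 1 × Set.Ioi (0 : ℝ) =>
            f p.1 * (p.2 * φ p.2))
        rw [finrank_euclideanSpace, Fintype.card_fin] at h
        rw [← h]
        congr with x
        have hx : 0 < ‖x.1‖ := norm_pos_iff.2 x.2
        simp only [homeomorphUnitSphereProd_apply_fst_coe, homeomorphUnitSphereProd_apply_snd_coe]
        rw [hf _ _ (inv_pos.2 hx)]
        field_simp
    _ = _ := integral_prod_mul (fun ξ : Metric.sphere (0 : EuclideanSpace ℝ (Fin n)) 1 => f ξ)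
        (fun r : Set.Ioi (0 : ℝ) => (r : ℝ) * φ r)

lemma sphereM_nonneg (K : Set (EuclideanSpace ℝ (Fin n))) : 0 ≤ sphereM K := by
  rw [sphereM, average_eq]
  exact smul_nonneg (by positivity) (integral_nonneg fun _ => gauge_nonneg _)

/-- The Gaussian average of a gauge is at most `√n` times its spherical average. -/
lemma integral_gauge_mul_gaussWeight_le [Nonempty (Fin n)] (K : Set (EuclideanSpace ℝ (Fin n))) :
    ∫ x, gauge K x * gaussWeight x ≤ √n * sphereM K * ∫ x, gaussWeight (n := n) x := by
  let φ : ℝ → ℝ := fun r => Real.exp (-(1 / 2) * r ^ 2)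
  let σ := (volume : Measure (EuclideanSpace ℝ (Fin n))).toSphere
  have h1 := integral_homogeneous_mul_radial (gauge K) (fun r x hr => by
    rw [gauge_smul_of_nonneg hr.le, smul_eq_mul]) φ
  have h2 := integral_homogeneous_mul_radial (n := n) (fun x => ‖x‖) (fun r x hr => by
    rw [norm_smul, Real.norm_of_nonneg hr.le]) φ
  have hσ0 : σ.real Set.univ ≠ 0 := by
    rw [measureReal_ne_zero_iff, Measure.measure_univ_ne_zero]
    exact Measure.toSphere_ne_zero _
  have h3 : ∫ ξ : Metric.sphere (0 : EuclideanSpace ℝ (Fin n)) 1,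
      ‖(ξ : EuclideanSpace ℝ (Fin n))‖ ∂σ = σ.real Set.univ := by simp
  have h4 : ∫ ξ : Metric.sphere (0 : EuclideanSpace ℝ (Fin n)) 1, gauge K ξ ∂σ
      = sphereM K * σ.real Set.univ := by
    rw [sphereM, average_eq, smul_eq_mul]
    change _ = (σ.real Set.univ)⁻¹ * (∫ ξ : Metric.sphere (0 : EuclideanSpace ℝ (Fin n)) 1,
      gauge K ξ ∂σ) * _
    field_simp
  have hM := sphereM_nonneg K
  calc ∫ x, gauge K x * gaussWeight x
      = sphereM K * ∫ x : EuclideanSpace ℝ (Fin n), ‖x‖ * gaussWeight x := by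
        refine h1.trans (Eq.trans ?_ (congrArg _ h2.symm))
        rw [h3, h4, mul_assoc]
    _ ≤ sphereM K * (√n * ∫ x : EuclideanSpace ℝ (Fin n), gaussWeight x) := by
        gcongr; exact integral_norm_mul_gaussWeight_le
    _ = _ := by ring

end Gauss

section Gauge

variable {n : ℕ} {K : Set (EuclideanSpace ℝ (Fin n))}

namespace IsSymmConvexBody

lemma neg_mem (hK : IsSymmConvexBody K) : ∀ x ∈ K, -x ∈ K := fun x hx => by
  have h := hK.2.2.2
  rw [h] at hx
  exact hx

lemma mem_nhds_zero (hK : IsSymmConvexBody K) : K ∈ nhds 0 := by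
  obtain ⟨x, hx⟩ := hK.2.2.1
  have hx' : -x ∈ interior K := by
    rw [mem_interior_iff_mem_nhds] at hx ⊢
    have hc : Filter.Tendsto (fun y : EuclideanSpace ℝ (Fin n) => -y) (nhds (-x)) (nhds x) := by
      simpa using (continuous_neg (G := EuclideanSpace ℝ (Fin n))).tendsto (-x)
    exact Filter.mem_of_superset (hc hx) fun y hy => by simpa using hK.neg_mem _ hy
  rw [← mem_interior_iff_mem_nhds]
  have := hK.1.interior hx hx' (a := 2⁻¹) (b := 2⁻¹) (by norm_num) (by norm_num) (by norm_num)
  simpa using this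

lemma continuous_gauge (hK : IsSymmConvexBody K) : Continuous (gauge K) :=
  _root_.continuous_gauge hK.1 hK.mem_nhds_zero

lemma gauge_neg (hK : IsSymmConvexBody K) (x : EuclideanSpace ℝ (Fin n)) :
    gauge K (-x) = gauge K x := _root_.gauge_neg hK.neg_mem x

lemma gauge_add_le (hK : IsSymmConvexBody K) (x y : EuclideanSpace ℝ (Fin n)) :
    gauge K (x + y) ≤ gauge K x + gauge K y :=
  _root_.gauge_add_le hK.1 (absorbent_nhds_zero hK.mem_nhds_zero) x y

lemma gauge_sub_le (hK : IsSymmConvexBody K) (x y : EuclideanSpace ℝ (Fin n)) :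
    gauge K (x - y) ≤ gauge K x + gauge K y := by
  rw [sub_eq_add_neg, ← hK.gauge_neg y]
  exact hK.gauge_add_le _ _

lemma exists_gauge_le_mul_norm (hK : IsSymmConvexBody K) : ∃ B : ℝ, ∀ x, gauge K x ≤ B * ‖x‖ := by
  obtain ⟨r, hr, hrK⟩ := Metric.mem_nhds_iff.1 hK.mem_nhds_zero
  refine ⟨r⁻¹, fun x => ?_⟩
  rw [← div_eq_inv_mul, le_div_iff₀ hr, mul_comm]
  exact mul_gauge_le_norm hrK

lemma integrable_gauge_mul_gaussWeight [Nonempty (Fin n)] (hK : IsSymmConvexBody K) :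
    Integrable fun x => gauge K x * gaussWeight x := by
  obtain ⟨B, hB⟩ := hK.exists_gauge_le_mul_norm
  have i1 := (integrable_norm_pow_mul_gaussWeight (n := n) 1).const_mul B
  refine i1.mono' (hK.continuous_gauge.mul continuous_gaussWeight).aestronglyMeasurable
    (Filter.Eventually.of_forall fun x => ?_)
  rw [Real.norm_of_nonneg (mul_nonneg (gauge_nonneg _) (gaussWeight_pos x).le), pow_one,
    ← mul_assoc]
  exact mul_le_mul_of_nonneg_right (hB x) (gaussWeight_pos x).le

end IsSymmConvexBody

lemma gaussWeight_neg (x : EuclideanSpace ℝ (Fin n)) : gaussWeight (-x) = gaussWeight x := by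
  simp [gaussWeight]

lemma two_mul_gaussWeight_le (x z : EuclideanSpace ℝ (Fin n)) :
    2 * (Real.exp (-(1 / 2) * ‖z‖ ^ 2) * gaussWeight x)
      ≤ gaussWeight (x + z) + gaussWeight (x - z) := by
  have h1 : gaussWeight (x + z) =
      Real.exp (-(1 / 2) * ‖z‖ ^ 2) * gaussWeight x * Real.exp (-⟪x, z⟫) := by
    simp only [gaussWeight, ← Real.exp_add, norm_add_sq_real]; congr 1; ring
  have h2 : gaussWeight (x - z) =
      Real.exp (-(1 / 2) * ‖z‖ ^ 2) * gaussWeight x * Real.exp ⟪x, z⟫ := by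
    simp only [gaussWeight, ← Real.exp_add, norm_sub_sq_real]; congr 1; ring
  rw [h1, h2, ← mul_add, mul_comm 2]
  refine mul_le_mul_of_nonneg_left ?_ (mul_pos (Real.exp_pos _) (gaussWeight_pos x)).le
  linarith [Real.add_one_le_exp (-⟪x, z⟫), Real.add_one_le_exp ⟪x, z⟫]

/-- Gaussian volumetric bound on the cardinality of a subset of a Euclidean ball which is separated
with respect to the gauge of `K`. -/
lemma card_separated_le [Nonempty (Fin n)] (hK : IsSymmConvexBody K) {g ρ r : ℝ} (hg : 0 < g)
    (hgK : ∫ x, gauge K x * gaussWeight x ≤ g * ∫ x, gaussWeight (n := n) x) (hr : 0 < r)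
    (P : Finset (EuclideanSpace ℝ (Fin n))) (hP : ∀ p ∈ P, ‖p‖ ≤ ρ)
    (hsep : ∀ p ∈ P, ∀ q ∈ P, p ≠ q → r < gauge K (p - q)) :
    (P.card : ℝ) ≤ 2 * Real.exp (8 * g ^ 2 * ρ ^ 2 / r ^ 2) := by
  classical
  let U : Set (EuclideanSpace ℝ (Fin n)) := {x | gauge K x ≤ 2 * g}
  have hU : MeasurableSet U := measurableSet_le hK.continuous_gauge.measurable measurable_const
  let u : EuclideanSpace ℝ (Fin n) → ℝ := U.indicator 1
  have hu : Measurable u := measurable_one.indicator hU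
  have hu0 : ∀ x, 0 ≤ u x := Set.indicator_nonneg fun _ _ => zero_le_one
  have hu1 : ∀ x, u x ≤ 1 := Set.indicator_le_self' (fun _ _ => zero_le_one)
  have hun : ∀ x, u (-x) = u x := fun x => by
    simp [u, U, Set.indicator, hK.gauge_neg]
  have hint : ∀ (v : EuclideanSpace ℝ (Fin n) → ℝ), Measurable v → (∀ x, 0 ≤ v x) →
      (∀ x, v x ≤ 1) → ∀ z, Integrable fun x => v x * gaussWeight (x + z) := by
    intro v hv h0 h1 z
    refine (integrable_gaussWeight.comp_add_right z).mono'
      (hv.mul (continuous_gaussWeight.measurable.comp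
        (measurable_add_const z))).aestronglyMeasurable
      (Filter.Eventually.of_forall fun x => ?_)
    rw [Real.norm_of_nonneg (mul_nonneg (h0 x) (gaussWeight_pos _).le)]
    exact mul_le_of_le_one_left (gaussWeight_pos _).le (h1 x)
  set W := ∫ x, gaussWeight (n := n) x with hW
  have hWpos : 0 < W := integral_gaussWeight_pos
  have hint0 : Integrable fun x => u x * gaussWeight x := by
    simpa using hint u hu hu0 hu1 0
  have hmarkov : W / 2 ≤ ∫ x, u x * gaussWeight x := by
    have hpt : ∀ x, gaussWeight x ≤ u x * gaussWeight x +
        (2 * g)⁻¹ * (gauge K x * gaussWeight x) := fun x => by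
      have : 1 ≤ u x + (2 * g)⁻¹ * gauge K x := by
        by_cases hx : x ∈ U
        · simp only [u, Set.indicator_of_mem hx, Pi.one_apply]
          have := gauge_nonneg (s := K) x
          have : 0 ≤ (2 * g)⁻¹ * gauge K x := by positivity
          linarith
        · have hx' : 2 * g < gauge K x := not_le.1 hx
          simp only [u, Set.indicator_of_notMem hx, zero_add]
          rw [← div_eq_inv_mul, le_div_iff₀ (by positivity)]
          linarith
      nlinarith [gaussWeight_pos x]
    have := integral_mono integrable_gaussWeight
      (hint0.add (hK.integrable_gauge_mul_gaussWeight.const_mul (2 * g)⁻¹)) hpt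
    simp only [Pi.add_apply] at this
    rw [integral_add hint0 (hK.integrable_gauge_mul_gaussWeight.const_mul _), integral_const_mul]
      at this
    have h2 : (2 * g)⁻¹ * ∫ x, gauge K x * gaussWeight x ≤ (2 * g)⁻¹ * (g * W) := by gcongr
    have h3 : (2 * g)⁻¹ * (g * W) = W / 2 := by field_simp
    linarith
  have hshift : ∀ z, Real.exp (-(1 / 2) * ‖z‖ ^ 2) * (W / 2) ≤
      ∫ x, u (x - z) * gaussWeight x := fun z => by
    have e1 : ∫ x, u (x - z) * gaussWeight x = ∫ x, u x * gaussWeight (x + z) := by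
      rw [← integral_add_right_eq_self _ z]
      simp
    have e2 : ∫ x, u x * gaussWeight (x - z) = ∫ x, u x * gaussWeight (x + z) := by
      rw [← integral_neg_eq_self]
      congr with x
      rw [hun, ← gaussWeight_neg]
      congr 2
      abel
    have hm : ∫ x, 2 * Real.exp (-(1 / 2) * ‖z‖ ^ 2) * (u x * gaussWeight x) ≤
        ∫ x, (u x * gaussWeight (x + z) + u x * gaussWeight (x - z)) := by
      refine integral_mono (hint0.const_mul _) ((hint u hu hu0 hu1 z).add ?_) fun x => ?_
      · simpa [sub_eq_add_neg] using hint u hu hu0 hu1 (-z)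
      · have := mul_le_mul_of_nonneg_left (two_mul_gaussWeight_le x z) (hu0 x)
        simp only
        linarith
    rw [integral_const_mul, integral_add (hint u hu hu0 hu1 z)
      (by simpa [sub_eq_add_neg] using hint u hu hu0 hu1 (-z)), e2] at hm
    rw [e1]
    have := mul_le_mul_of_nonneg_left hmarkov (Real.exp_pos (-(1 / 2) * ‖z‖ ^ 2)).le
    linarith
  set c := 4 * g / r with hc
  have hc0 : 0 < c := by positivity
  have hdisj : ∀ x, ∑ p ∈ P, u (x - c • p) ≤ 1 := by
    intro x
    by_cases hx : ∃ p ∈ P, x - c • p ∈ U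
    · obtain ⟨p, hp, hpU⟩ := hx
      rw [Finset.sum_eq_single_of_mem p hp]
      · exact hu1 _
      · intro q hq hqp
        refine Set.indicator_of_notMem (fun hqU => ?_) _
        have h1 : gauge K (c • (p - q)) ≤ 2 * g + 2 * g := by
          have : c • (p - q) = (x - c • q) - (x - c • p) := by rw [smul_sub]; abel
          rw [this]
          exact (hK.gauge_sub_le _ _).trans (add_le_add hqU hpU)
        rw [gauge_smul_of_nonneg hc0.le, smul_eq_mul] at h1
        have h2 := mul_lt_mul_of_pos_left (hsep p hp q hq hqp.symm) hc0
        have h3 : c * r = 4 * g := by rw [hc]; field_simp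
        linarith
    · push Not at hx
      rw [Finset.sum_eq_zero fun p hp => Set.indicator_of_notMem (hx p hp) _]
      exact zero_le_one
  have hints : ∀ p ∈ P, Integrable fun x => u (x - c • p) * gaussWeight x := fun p _ => by
    simpa using hint (fun x => u (x - c • p)) (hu.comp (measurable_sub_const _)) (fun _ => hu0 _)
      (fun _ => hu1 _) 0
  have hsum : ∑ p ∈ P, ∫ x, u (x - c • p) * gaussWeight x ≤ W := by
    rw [← integral_finsetSum _ hints]
    refine integral_mono (integrable_finsetSum _ hints) integrable_gaussWeight fun x => ?_
    simp only [← Finset.sum_mul]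
    exact mul_le_of_le_one_left (gaussWeight_pos x).le (hdisj x)
  have hlow : ∀ p ∈ P, Real.exp (-(8 * g ^ 2 * ρ ^ 2 / r ^ 2)) * (W / 2) ≤
      ∫ x, u (x - c • p) * gaussWeight x := fun p hp => by
    refine le_trans ?_ (hshift (c • p))
    gcongr
    rw [norm_smul, Real.norm_of_nonneg hc0.le, mul_pow]
    have h1 : ‖p‖ ^ 2 ≤ ρ ^ 2 := pow_le_pow_left₀ (norm_nonneg _) (hP p hp) 2
    have h2 : 8 * g ^ 2 * ρ ^ 2 / r ^ 2 = 1 / 2 * (c ^ 2 * ρ ^ 2) := by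
      rw [hc]; field_simp; ring
    rw [h2]
    nlinarith [sq_nonneg c]
  have hfin := (Finset.sum_le_sum hlow).trans hsum
  rw [Finset.sum_const, nsmul_eq_mul, Real.exp_neg] at hfin
  have hE := Real.exp_pos (8 * g ^ 2 * ρ ^ 2 / r ^ 2)
  have : (P.card : ℝ) * ((Real.exp (8 * g ^ 2 * ρ ^ 2 / r ^ 2))⁻¹ * (W / 2)) =
      (P.card : ℝ) / (2 * Real.exp (8 * g ^ 2 * ρ ^ 2 / r ^ 2)) * W := by field_simp
  rw [this] at hfin
  have := le_of_mul_le_mul_right (hfin.trans_eq (one_mul W).symm) hWpos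
  rwa [div_le_one (by positivity)] at this

/-- Dual Sudakov inequality: covering of a Euclidean ball by translates of a multiple of `K`. -/
lemma exists_finset_cover_ball [Nonempty (Fin n)] (hK : IsSymmConvexBody K) {g ρ r : ℝ} (hg : 0 < g)
    (hgK : ∫ x, gauge K x * gaussWeight x ≤ g * ∫ x, gaussWeight (n := n) x) (hr : 0 < r) :
    ∃ F : Finset (EuclideanSpace ℝ (Fin n)),
      (F.card : ℝ) ≤ 2 * Real.exp (8 * g ^ 2 * ρ ^ 2 / r ^ 2) ∧
      ∀ x, ‖x‖ ≤ ρ → ∃ y ∈ F, gauge K (x - y) ≤ r := by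
  classical
  let Sep : Finset (EuclideanSpace ℝ (Fin n)) → Prop := fun P =>
    (∀ p ∈ P, ‖p‖ ≤ ρ) ∧ ∀ p ∈ P, ∀ q ∈ P, p ≠ q → r < gauge K (p - q)
  have hbd : ∀ P, Sep P → (P.card : ℝ) ≤ 2 * Real.exp (8 * g ^ 2 * ρ ^ 2 / r ^ 2) := fun P hP =>
    card_separated_le hK hg hgK hr P hP.1 hP.2
  let A : Set ℕ := {k | ∃ P, Sep P ∧ P.card = k}
  have hA : BddAbove A := ⟨⌊2 * Real.exp (8 * g ^ 2 * ρ ^ 2 / r ^ 2)⌋₊, by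
    rintro k ⟨P, hP, rfl⟩
    exact Nat.le_floor (hbd P hP)⟩
  obtain ⟨P, hP, hcard⟩ := Nat.sSup_mem (s := A) ⟨0, ∅, by simp [Sep], rfl⟩ hA
  refine ⟨P, hbd P hP, fun x hx => ?_⟩
  by_contra! hcon
  have hxP : x ∉ P := fun h => by
    have := hcon x h
    rw [sub_self, gauge_zero] at this
    linarith
  have hins : Sep (insert x P) := by
    refine ⟨fun p hp => ?_, fun p hp q hq hpq => ?_⟩
    · rcases Finset.mem_insert.1 hp with rfl | hp'
      · exact hx
      · exact hP.1 p hp'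
    · rcases Finset.mem_insert.1 hp with rfl | hp' <;>
        rcases Finset.mem_insert.1 hq with rfl | hq'
      · exact absurd rfl hpq
      · exact hcon q hq'
      · rw [← neg_sub, hK.gauge_neg]
        exact hcon p hp'
      · exact hP.2 p hp' q hq' hpq
  have := le_csSup hA ⟨_, hins, rfl⟩
  rw [Finset.card_insert_of_notMem hxP, hcard] at this
  omega

end Gauge

/-- The polar set of `K`. -/
def polarBody {n : ℕ} (K : Set (EuclideanSpace ℝ (Fin n))) : Set (EuclideanSpace ℝ (Fin n)) :=
  {y | ∀ x ∈ K, ⟪x, y⟫ ≤ 1}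

section Polar

variable {n : ℕ} {K : Set (EuclideanSpace ℝ (Fin n))}

lemma zero_mem_polarBody : (0 : EuclideanSpace ℝ (Fin n)) ∈ polarBody K := fun x _ => by simp

lemma inner_le_gauge (hK : IsSymmConvexBody K) {y : EuclideanSpace ℝ (Fin n)}
    (hy : y ∈ polarBody K) (x : EuclideanSpace ℝ (Fin n)) : ⟪x, y⟫ ≤ gauge K x := by
  refine le_of_forall_gt fun a ha => ?_
  obtain ⟨b, hb, hba, z, hz, rfl⟩ :=
    exists_lt_of_gauge_lt (absorbent_nhds_zero hK.mem_nhds_zero) ha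
  rw [real_inner_smul_left]
  have := hy z hz
  nlinarith

lemma abs_inner_le_gauge (hK : IsSymmConvexBody K) {y : EuclideanSpace ℝ (Fin n)}
    (hy : y ∈ polarBody K) (x : EuclideanSpace ℝ (Fin n)) : |⟪x, y⟫| ≤ gauge K x := by
  refine abs_le'.2 ⟨inner_le_gauge hK hy x, ?_⟩
  rw [← inner_neg_left, ← hK.gauge_neg]
  exact inner_le_gauge hK hy (-x)

lemma gauge_le_of_forall_inner_le (hK : IsSymmConvexBody K) {v : EuclideanSpace ℝ (Fin n)} {B : ℝ}
    (hB : 0 ≤ B) (h : ∀ y ∈ polarBody K, ⟪v, y⟫ ≤ B) : gauge K v ≤ B := by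
  refine le_of_forall_gt_imp_ge_of_dense fun a ha => ?_
  have ha0 : 0 < a := hB.trans_lt ha
  refine gauge_le_of_mem ha0.le ?_
  rw [Set.mem_smul_set_iff_inv_smul_mem₀ ha0.ne']
  by_contra hv
  obtain ⟨f, u, hfu, huv⟩ := geometric_hahn_banach_closed_point hK.1 hK.2.1.isClosed hv
  have hu : 0 < u := by simpa using hfu 0 (mem_of_mem_nhds hK.mem_nhds_zero)
  set y := (InnerProductSpace.toDual ℝ (EuclideanSpace ℝ (Fin n))).symm f with hy
  have hfy : ∀ x, f x = ⟪x, y⟫ := fun x => by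
    rw [real_inner_comm, hy, InnerProductSpace.toDual_symm_apply]
  have hyT : u⁻¹ • y ∈ polarBody K := fun x hx => by
    rw [real_inner_smul_right, ← hfy, ← div_eq_inv_mul, div_le_one hu]
    exact (hfu x hx).le
  have h1 := h _ hyT
  rw [hfy, real_inner_smul_left, ← div_eq_inv_mul, lt_div_iff₀ ha0] at huv
  rw [real_inner_smul_right, ← div_eq_inv_mul, div_le_iff₀ hu] at h1
  nlinarith

lemma norm_le_of_mem_polarBody [Nonempty (Fin n)] (hK : IsSymmConvexBody K) {g : ℝ} (hg : 0 < g)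
    (hgK : ∫ x, gauge K x * gaussWeight x ≤ g * ∫ x, gaussWeight (n := n) x)
    {y : EuclideanSpace ℝ (Fin n)} (hy : y ∈ polarBody K) : ‖y‖ ≤ 5 * g := by
  classical
  by_contra! hlt
  have hy0 : 0 < ‖y‖ := lt_trans (by positivity) hlt
  set θ := ‖y‖⁻¹ • y with hθ
  have hθn : ‖θ‖ = 1 := by rw [hθ, norm_smul, norm_inv, norm_norm, inv_mul_cancel₀ hy0.ne']
  have hθ0 : θ ≠ 0 := fun h => by simp [h] at hθn
  have hθK : 5 * g < gauge K θ := by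
    refine hlt.trans_le (le_trans (le_of_eq ?_) (inner_le_gauge hK hy θ))
    rw [hθ, real_inner_smul_left, real_inner_self_eq_norm_sq]
    field_simp
  have hθK2 : 5 * g < gauge K (θ + θ) := by
    rw [← two_smul ℝ θ, gauge_smul_of_nonneg (by norm_num), smul_eq_mul]
    linarith
  have hne : θ ≠ -θ := fun h => by
    rw [eq_neg_iff_add_eq_zero.1 h, gauge_zero] at hθK2
    linarith
  have hcard : ({0, θ, -θ} : Finset (EuclideanSpace ℝ (Fin n))).card = 3 := by
    rw [Finset.card_eq_three]
    exact ⟨0, θ, -θ, hθ0.symm, fun h => hθ0 (by simpa using h.symm), hne, rfl⟩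
  have := card_separated_le hK hg hgK (ρ := 1) (r := 5 * g) (by positivity) {0, θ, -θ}
    (by simp [hθn]) (by
      have e1 : gauge K (-θ) = gauge K θ := hK.gauge_neg θ
      have e2 : gauge K (-θ - θ) = gauge K (θ + θ) := by
        rw [← hK.gauge_neg]; congr 1; abel
      simp only [Finset.mem_insert, Finset.mem_singleton]
      rintro p (rfl | rfl | rfl) q (rfl | rfl | rfl) hpq <;>
        first
          | exact absurd rfl hpq
          | simpa [e1, e2] using hθK
          | simpa [e1, e2] using hθK2)
  rw [hcard] at this
  have e : 8 * g ^ 2 * 1 ^ 2 / (5 * g) ^ 2 = 8 / 25 := by field_simp; norm_num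
  rw [e] at this
  have h3 : Real.exp (8 / 25) ^ 3 ≤ 2.7182818286 := by
    rw [← Real.exp_nat_mul]
    refine le_trans (Real.exp_le_exp.2 ?_) Real.exp_one_lt_d9.le
    norm_num
  have h4 : (3 / 2 : ℝ) ≤ Real.exp (8 / 25) := by push_cast at this; linarith
  have := pow_le_pow_left₀ (by norm_num) h4 3
  norm_num at this h3
  linarith

end Polar

section Nets

variable {n : ℕ} {K : Set (EuclideanSpace ℝ (Fin n))}

lemma exists_refined_net [Nonempty (Fin n)] (hK : IsSymmConvexBody K) {g ε : ℝ} (hg : 0 < g)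
    (hgK : ∫ x, gauge K x * gaussWeight x ≤ g * ∫ x, gaussWeight (n := n) x) (hε : 0 < ε)
    (F : Finset (EuclideanSpace ℝ (Fin n)))
    (hF : ∀ y ∈ polarBody K, ∃ p ∈ F, ‖y - p‖ ≤ 2 * ε) :
    ∃ F' : Finset (EuclideanSpace ℝ (Fin n)), (∀ q ∈ F', q ∈ polarBody K) ∧
      (F'.card : ℝ) ≤ F.card * (2 * Real.exp (512 * g ^ 2 / ε ^ 2)) ∧
      ∀ y ∈ polarBody K, ∃ q ∈ F', ‖y - q‖ ≤ ε := by
  classical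
  obtain ⟨Z, hZ, hcov⟩ := exists_finset_cover_ball hK (ρ := 2 * ε) (r := ε ^ 2 / 4) hg hgK
    (by positivity)
  have hex : ∀ pz : EuclideanSpace ℝ (Fin n) × EuclideanSpace ℝ (Fin n), ∃ q ∈ polarBody K,
      (∃ y ∈ polarBody K, gauge K (y - pz.1 - pz.2) ≤ ε ^ 2 / 4) →
        gauge K (q - pz.1 - pz.2) ≤ ε ^ 2 / 4 := fun pz => by
    by_cases h : ∃ y ∈ polarBody K, gauge K (y - pz.1 - pz.2) ≤ ε ^ 2 / 4
    · obtain ⟨q, hq, hq'⟩ := h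
      exact ⟨q, hq, fun _ => hq'⟩
    · exact ⟨0, zero_mem_polarBody, fun h' => absurd h' h⟩
  choose q hqT hq using hex
  refine ⟨(F ×ˢ Z).image q, fun p hp => ?_, ?_, fun y hy => ?_⟩
  · obtain ⟨pz, -, rfl⟩ := Finset.mem_image.1 hp
    exact hqT pz
  · have h1 : (((F ×ˢ Z).image q).card : ℝ) ≤ F.card * Z.card := by
      exact_mod_cast Finset.card_image_le.trans_eq (Finset.card_product F Z)
    have e : 8 * g ^ 2 * (2 * ε) ^ 2 / (ε ^ 2 / 4) ^ 2 = 512 * g ^ 2 / ε ^ 2 := by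
      field_simp; norm_num
    rw [e] at hZ
    exact h1.trans (mul_le_mul_of_nonneg_left hZ (Nat.cast_nonneg _))
  · obtain ⟨p, hp, hyp⟩ := hF y hy
    obtain ⟨z, hz, hyz⟩ := hcov _ hyp
    refine ⟨q (p, z), Finset.mem_image_of_mem _ (Finset.mk_mem_product hp hz), ?_⟩
    have h1 := hq (p, z) ⟨y, hy, hyz⟩
    have h2 : gauge K (y - q (p, z)) ≤ ε ^ 2 / 2 := by
      have : y - q (p, z) = (y - p - z) - (q (p, z) - p - z) := by abel
      rw [this]
      refine (hK.gauge_sub_le _ _).trans ?_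
      simp only at h1
      linarith
    have h3 := abs_le.1 (abs_inner_le_gauge hK hy (y - q (p, z)))
    have h4 := abs_le.1 (abs_inner_le_gauge hK (hqT (p, z)) (y - q (p, z)))
    have h5 : ‖y - q (p, z)‖ ^ 2 ≤ ε ^ 2 := by
      rw [← real_inner_self_eq_norm_sq, inner_sub_right]
      linarith
    exact (pow_le_pow_iff_left₀ (norm_nonneg _) hε.le two_ne_zero).1 h5

/-- Successive nets of the polar body at dyadic Euclidean scales. -/
lemma exists_nets_polarBody [Nonempty (Fin n)] (hK : IsSymmConvexBody K) {g : ℝ} (hg : 0 < g)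
    (hgK : ∫ x, gauge K x * gaussWeight x ≤ g * ∫ x, gaussWeight (n := n) x) :
    ∃ F : ℕ → Finset (EuclideanSpace ℝ (Fin n)), F 0 = {0} ∧
      ∀ k, (∀ q ∈ F k, q ∈ polarBody K) ∧ ((F k).card : ℝ) ≤ Real.exp (29 * 4 ^ k) ∧
        ∀ y ∈ polarBody K, ∃ q ∈ F k, ‖y - q‖ ≤ 5 * g / 2 ^ k := by
  have key : ∀ k : ℕ, ∃ F : Finset (EuclideanSpace ℝ (Fin n)), (k = 0 → F = {0}) ∧
      (∀ q ∈ F, q ∈ polarBody K) ∧ (F.card : ℝ) ≤ Real.exp (29 * 4 ^ k) ∧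
        ∀ y ∈ polarBody K, ∃ q ∈ F, ‖y - q‖ ≤ 5 * g / 2 ^ k := by
    intro k
    induction k with
    | zero =>
      refine ⟨{0}, fun _ => rfl, by simpa using zero_mem_polarBody, by simp, fun y hy => ?_⟩
      simpa using norm_le_of_mem_polarBody hK hg hgK hy
    | succ k ih =>
      obtain ⟨F, -, -, hcard, hnet⟩ := ih
      have hε : (0 : ℝ) < 5 * g / 2 ^ (k + 1) := by positivity
      have h2ε : 2 * (5 * g / 2 ^ (k + 1)) = 5 * g / 2 ^ k := by rw [pow_succ]; field_simp
      obtain ⟨F', hT, hc, hn⟩ := exists_refined_net hK hg hgK hε F (by rwa [h2ε])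
      refine ⟨F', by simp, hT, hc.trans ?_, hn⟩
      have e : 512 * g ^ 2 / (5 * g / 2 ^ (k + 1)) ^ 2 = 2048 / 25 * 4 ^ k := by
        have : (4 : ℝ) ^ k = (2 ^ k) ^ 2 := by rw [← pow_mul, mul_comm, pow_mul]; norm_num
        rw [this]
        field_simp
        ring
      have h4 : (1 : ℝ) ≤ 4 ^ k := one_le_pow₀ (by norm_num)
      have h2 : (2 : ℝ) ≤ Real.exp (4 ^ k) := by linarith [Real.add_one_le_exp ((4 : ℝ) ^ k)]
      rw [e]
      calc (F.card : ℝ) * (2 * Real.exp (2048 / 25 * 4 ^ k))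
          ≤ Real.exp (29 * 4 ^ k) * (Real.exp (4 ^ k) * Real.exp (2048 / 25 * 4 ^ k)) := by gcongr
        _ ≤ Real.exp (29 * 4 ^ (k + 1)) := by
          rw [← Real.exp_add, ← Real.exp_add, Real.exp_le_exp, pow_succ]
          linarith
  choose F hF0 hF using key
  exact ⟨F, hF0 0 rfl, hF⟩

end Nets

section Chaining

variable {n : ℕ} {K : Set (EuclideanSpace ℝ (Fin n))}

/-- The normalised increment `(p - q) / ε`, truncated to the unit ball. -/
def chainLink (ε : ℝ) (p q : EuclideanSpace ℝ (Fin n)) : EuclideanSpace ℝ (Fin n) :=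
  open scoped Classical in if ‖p - q‖ ≤ ε then ε⁻¹ • (p - q) else 0

lemma norm_chainLink_le {ε : ℝ} (hε : 0 < ε) (p q : EuclideanSpace ℝ (Fin n)) :
    ‖chainLink ε p q‖ ≤ 1 := by
  unfold chainLink
  split_ifs with h
  · rw [norm_smul, norm_inv, Real.norm_of_nonneg hε.le, ← div_eq_inv_mul, div_le_one hε]
    exact h
  · simp

/-- A smooth upper bound for the increments of `v` over the links between `P` and `Q`. -/
def chainBound (P Q : Finset (EuclideanSpace ℝ (Fin n))) (ε κ b : ℝ)
    (v : EuclideanSpace ℝ (Fin n)) : ℝ :=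
  ε * κ * (b + Real.exp (-b) * ∑ x ∈ P ×ˢ Q, Real.exp (⟪v, chainLink ε x.1 x.2⟫ / κ))

lemma continuous_chainBound (P Q : Finset (EuclideanSpace ℝ (Fin n))) (ε κ b : ℝ) :
    Continuous (chainBound P Q ε κ b) := by
  unfold chainBound
  fun_prop

lemma inner_sub_le_chainBound {P Q : Finset (EuclideanSpace ℝ (Fin n))} {ε κ b : ℝ} (hε : 0 < ε)
    (hκ : 0 < κ) (v : EuclideanSpace ℝ (Fin n)) {p q : EuclideanSpace ℝ (Fin n)} (hp : p ∈ P)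
    (hq : q ∈ Q) (hpq : ‖p - q‖ ≤ ε) : ⟪v, p - q⟫ ≤ chainBound P Q ε κ b v := by
  have h1 : ⟪v, p - q⟫ = ε * κ * (⟪v, chainLink ε p q⟫ / κ) := by
    rw [chainLink, if_pos hpq, real_inner_smul_right]
    field_simp
  have h2 : Real.exp (⟪v, chainLink ε p q⟫ / κ) ≤
      ∑ x ∈ P ×ˢ Q, Real.exp (⟪v, chainLink ε x.1 x.2⟫ / κ) :=
    Finset.single_le_sum (a := (p, q))
      (f := fun x : EuclideanSpace ℝ (Fin n) × EuclideanSpace ℝ (Fin n) =>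
        Real.exp (⟪v, chainLink ε x.1 x.2⟫ / κ))
      (fun _ _ => (Real.exp_pos _).le) (Finset.mk_mem_product hp hq)
  rw [h1, chainBound]
  refine mul_le_mul_of_nonneg_left ?_ (by positivity)
  have h3 := Real.add_one_le_exp (-b + ⟪v, chainLink ε p q⟫ / κ)
  rw [Real.exp_add] at h3
  have h4 := mul_le_mul_of_nonneg_left h2 (Real.exp_pos (-b)).le
  linarith

variable {Ω : Type*} [MeasurableSpace Ω] {μ : Measure Ω} [IsProbabilityMeasure μ]
  {Y : Ω → EuclideanSpace ℝ (Fin n)} {κ : ℝ}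

lemma integral_chainBound_le
    (hY : ∀ f : EuclideanSpace ℝ (Fin n) → ℝ, Continuous f → Integrable (fun ω => f (Y ω)) μ)
    (hκ : 0 < κ)
    (hexp : ∀ θ : EuclideanSpace ℝ (Fin n), ‖θ‖ ≤ 1 → ∫ ω, Real.exp (⟪Y ω, θ⟫ / κ) ∂μ ≤ 2)
    {P Q : Finset (EuclideanSpace ℝ (Fin n))} {ε b : ℝ} (hε : 0 < ε)
    (hb : (P.card : ℝ) * Q.card ≤ Real.exp b) :
    ∫ ω, chainBound P Q ε κ b (Y ω) ∂μ ≤ ε * κ * (b + 2) := by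
  have hi : ∀ θ : EuclideanSpace ℝ (Fin n), Integrable (fun ω => Real.exp (⟪Y ω, θ⟫ / κ)) μ :=
    fun θ => hY (fun v => Real.exp (⟪v, θ⟫ / κ)) (by fun_prop)
  unfold chainBound
  rw [integral_const_mul, integral_add (integrable_const _)
    ((integrable_finsetSum _ fun x _ => hi _).const_mul _), integral_const_mul,
    integral_finsetSum _ fun x _ => hi _]
  refine mul_le_mul_of_nonneg_left ?_ (by positivity)
  have h1 : ∑ x ∈ P ×ˢ Q, ∫ ω, Real.exp (⟪Y ω, chainLink ε x.1 x.2⟫ / κ) ∂μ ≤ Real.exp b * 2 := by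
    refine (Finset.sum_le_card_nsmul _ _ 2 fun x _ => hexp _ (norm_chainLink_le hε _ _)).trans ?_
    rw [Finset.card_product, nsmul_eq_mul]
    push_cast
    gcongr
  have h2 := mul_le_mul_of_nonneg_left h1 (Real.exp_pos (-b)).le
  rw [← mul_assoc, ← Real.exp_add, neg_add_cancel, Real.exp_zero, one_mul] at h2
  simpa using h2

lemma sq_le_two_mul_exp_add_exp_neg (x : ℝ) : x ^ 2 ≤ 2 * (Real.exp x + Real.exp (-x)) := by
  rcases le_total 0 x with h | h
  · have := Real.quadratic_le_exp_of_nonneg h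
    have := Real.exp_pos (-x)
    linarith
  · have := Real.quadratic_le_exp_of_nonneg (neg_nonneg.2 h)
    have := Real.exp_pos x
    rw [neg_sq] at *
    linarith

lemma integral_norm_le_of_exp_moment [Nonempty (Fin n)]
    (hY : ∀ f : EuclideanSpace ℝ (Fin n) → ℝ, Continuous f → Integrable (fun ω => f (Y ω)) μ)
    (hκ : 0 < κ)
    (hexp : ∀ θ : EuclideanSpace ℝ (Fin n), ‖θ‖ ≤ 1 → ∫ ω, Real.exp (⟪Y ω, θ⟫ / κ) ∂μ ≤ 2) :
    ∫ ω, ‖Y ω‖ ∂μ ≤ 5 * Real.sqrt n * κ := by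
  have hn : (0 : ℝ) < n := by exact_mod_cast Fin.pos_iff_nonempty.2 ‹_›
  set a := Real.sqrt n * κ with ha
  have ha0 : 0 < a := mul_pos (Real.sqrt_pos.2 hn) hκ
  have ha2 : a ^ 2 = n * κ ^ 2 := by rw [ha, mul_pow, Real.sq_sqrt hn.le]
  let e : Fin n → EuclideanSpace ℝ (Fin n) := fun i => EuclideanSpace.single i 1
  have hi : ∀ θ : EuclideanSpace ℝ (Fin n), Integrable (fun ω => Real.exp (⟪Y ω, θ⟫ / κ)) μ :=
    fun θ => hY (fun v => Real.exp (⟪v, θ⟫ / κ)) (by fun_prop)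
  have hpt : ∀ v : EuclideanSpace ℝ (Fin n), ‖v‖ ≤ a / 2 + κ ^ 2 / a *
      ∑ i, (Real.exp (⟪v, e i⟫ / κ) + Real.exp (⟪v, -e i⟫ / κ)) := fun v => by
    have h1 : ‖v‖ ^ 2 ≤ κ ^ 2 * (2 *
        ∑ i, (Real.exp (⟪v, e i⟫ / κ) + Real.exp (⟪v, -e i⟫ / κ))) := by
      rw [EuclideanSpace.norm_sq_eq, Finset.mul_sum, Finset.mul_sum]
      refine Finset.sum_le_sum fun i _ => ?_
      have h2 := mul_le_mul_of_nonneg_left (sq_le_two_mul_exp_add_exp_neg (⟪v, e i⟫ / κ))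
        (sq_nonneg κ)
      have h3 : ⟪v, e i⟫ = v i := by simp [e, EuclideanSpace.inner_single_right]
      have h4 : κ ^ 2 * (⟪v, e i⟫ / κ) ^ 2 = ‖v i‖ ^ 2 := by
        rw [h3, Real.norm_eq_abs, sq_abs]; field_simp
      rw [h4] at h2
      rw [inner_neg_right, neg_div]
      exact h2
    have h5 : ‖v‖ ≤ a / 2 + ‖v‖ ^ 2 / (2 * a) := by
      have : a / 2 + ‖v‖ ^ 2 / (2 * a) - ‖v‖ = (‖v‖ - a) ^ 2 / (2 * a) := by field_simp; ring
      have : 0 ≤ (‖v‖ - a) ^ 2 / (2 * a) := by positivity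
      linarith
    refine h5.trans (add_le_add_right ?_ _)
    rw [div_le_iff₀ (by positivity)]
    refine h1.trans_eq ?_
    field_simp
  have hisum : Integrable (fun ω => ∑ i, (Real.exp (⟪Y ω, e i⟫ / κ) +
      Real.exp (⟪Y ω, -e i⟫ / κ))) μ := integrable_finsetSum _ fun i _ => (hi _).add (hi _)
  have h := integral_mono (hY _ continuous_norm)
    ((integrable_const (a / 2)).add (hisum.const_mul (κ ^ 2 / a))) fun ω => hpt (Y ω)
  simp only [Pi.add_apply] at h
  rw [integral_add (integrable_const _) (hisum.const_mul _), integral_const_mul,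
    integral_finsetSum _ fun i _ => show Integrable (fun ω =>
      Real.exp (⟪Y ω, e i⟫ / κ) + Real.exp (⟪Y ω, -e i⟫ / κ)) μ from (hi _).add (hi _)] at h
  have hs : ∑ i, ∫ ω, (Real.exp (⟪Y ω, e i⟫ / κ) + Real.exp (⟪Y ω, -e i⟫ / κ)) ∂μ ≤ n * 4 := by
    refine (Finset.sum_le_card_nsmul _ _ 4 fun i _ => ?_).trans_eq (by simp)
    rw [integral_add (hi _) (hi _)]
    have h1 := hexp (e i) (by simp [e])
    have h2 := hexp (-e i) (by simp [e])
    linarith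
  have hs' := mul_le_mul_of_nonneg_left hs (show 0 ≤ κ ^ 2 / a by positivity)
  have e1 : κ ^ 2 / a * (n * 4) = 4 * a := by
    rw [div_mul_eq_mul_div, div_eq_iff ha0.ne']
    linarith
  have e2 : ∫ _, a / 2 ∂μ = a / 2 := by simp
  rw [e2] at h
  rw [mul_assoc, ← ha]
  linarith

lemma exists_dyadic_near_rpow (hn : 1 ≤ n) : ∃ m : ℕ,
    (n : ℝ) ^ ((1 : ℝ) / 4) ≤ 2 ^ m ∧ (2 : ℝ) ^ m ≤ 2 * (n : ℝ) ^ ((1 : ℝ) / 4) := by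
  obtain ⟨m, h1, h2⟩ := exists_nat_pow_near (x := (n : ℝ) ^ ((1 : ℝ) / 4)) (y := 2)
    (Real.one_le_rpow (by exact_mod_cast hn) (by norm_num)) one_lt_two
  exact ⟨m + 1, h2.le, by rw [pow_succ]; linarith⟩

/-- Expected gauge of a random vector with uniformly bounded exponential moments. -/
lemma integral_gauge_le_of_exp_moment [Nonempty (Fin n)] (hK : IsSymmConvexBody K) {g : ℝ}
    (hg : 0 < g) (hgK : ∫ x, gauge K x * gaussWeight x ≤ g * ∫ x, gaussWeight (n := n) x)
    (hY : ∀ f : EuclideanSpace ℝ (Fin n) → ℝ, Continuous f → Integrable (fun ω => f (Y ω)) μ)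
    (hκ : 0 < κ)
    (hexp : ∀ θ : EuclideanSpace ℝ (Fin n), ‖θ‖ ≤ 1 → ∫ ω, Real.exp (⟪Y ω, θ⟫ / κ) ∂μ ≤ 2) :
    ∫ ω, gauge K (Y ω) ∂μ ≤ 1500 * g * κ * (n : ℝ) ^ ((1 : ℝ) / 4) := by
  obtain ⟨F, hF0, hF⟩ := exists_nets_polarBody hK hg hgK
  let ε : ℕ → ℝ := fun k => 5 * g / 2 ^ k
  have hε : ∀ k, 0 < ε k := fun k => by positivity
  let S : ℕ → EuclideanSpace ℝ (Fin n) → ℝ := fun k =>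
    chainBound (F (k + 1)) (F k) (ε k) κ (145 * 4 ^ k)
  have hS : ∀ k, ∫ ω, S k (Y ω) ∂μ ≤ ε k * κ * (145 * 4 ^ k + 2) := fun k => by
    refine integral_chainBound_le hY hκ hexp (hε k) ?_
    refine (mul_le_mul (hF _).2.1 (hF _).2.1 (Nat.cast_nonneg _) (Real.exp_pos _).le).trans ?_
    rw [← Real.exp_add, Real.exp_le_exp, pow_succ]
    linarith
  have htree : ∀ (v : EuclideanSpace ℝ (Fin n)) (m : ℕ), ∀ p ∈ F m,
      ⟪v, p⟫ ≤ ∑ k ∈ Finset.range m, S k v := by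
    intro v m
    induction m with
    | zero => simp [hF0]
    | succ m ih =>
      intro p hp
      obtain ⟨q, hq, hpq⟩ := (hF m).2.2 p ((hF _).1 p hp)
      rw [Finset.sum_range_succ]
      have h1 := inner_sub_le_chainBound (b := 145 * 4 ^ m) (hε m) hκ v hp hq hpq
      rw [inner_sub_right] at h1
      have h2 := ih q hq
      simp only [S] at h2 ⊢
      linarith
  obtain ⟨m, hm1, hm2⟩ := exists_dyadic_near_rpow (n := n) (Fin.pos_iff_nonempty.2 ‹_›)
  set a := (n : ℝ) ^ ((1 : ℝ) / 4) with ha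
  have ha1 : 1 ≤ a := Real.one_le_rpow
    (by exact_mod_cast (Fin.pos_iff_nonempty.2 ‹_› : 0 < n)) (by norm_num)
  have ha2 : Real.sqrt n = a ^ 2 := by
    rw [ha, ← Real.rpow_natCast, ← Real.rpow_mul (Nat.cast_nonneg _), Real.sqrt_eq_rpow]
    norm_num
  have hpt : ∀ v, gauge K v ≤ (∑ k ∈ Finset.range m, S k v) + ε m * ‖v‖ := fun v => by
    have key : ∀ y ∈ polarBody K, ⟪v, y⟫ ≤ (∑ k ∈ Finset.range m, S k v) + ε m * ‖v‖ := by
      intro y hy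
      obtain ⟨p, hp, hyp⟩ := (hF m).2.2 y hy
      have h1 := htree v m p hp
      have h2 : ⟪v, y - p⟫ ≤ ε m * ‖v‖ := by
        rw [mul_comm]
        exact (real_inner_le_norm _ _).trans (mul_le_mul_of_nonneg_left hyp (norm_nonneg _))
      rw [inner_sub_right] at h2
      linarith
    exact gauge_le_of_forall_inner_le hK (by simpa using key 0 zero_mem_polarBody) key
  have hSi : ∀ k ∈ Finset.range m, Integrable (fun ω => S k (Y ω)) μ := fun k _ =>
    hY _ (continuous_chainBound _ _ _ _ _)
  have h := integral_mono (hY _ hK.continuous_gauge)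
    ((integrable_finsetSum _ hSi).add ((hY _ continuous_norm).const_mul (ε m))) fun ω => hpt (Y ω)
  simp only [Pi.add_apply] at h
  rw [integral_add (integrable_finsetSum _ hSi) ((hY _ continuous_norm).const_mul _),
    integral_const_mul, integral_finsetSum _ hSi] at h
  have hsum : ∀ m : ℕ, ∑ k ∈ Finset.range m, ε k * κ * (145 * 4 ^ k + 2) ≤
      g * κ * (725 * 2 ^ m + 20) - g * κ * 20 / 2 ^ m := by
    intro m
    induction m with
    | zero => simp; nlinarith [mul_pos hg hκ]
    | succ m ih =>
      rw [Finset.sum_range_succ]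
      refine (add_le_add_left ih _).trans (le_of_eq ?_)
      have h4 : (4 : ℝ) ^ m = (2 ^ m) ^ 2 := by rw [← pow_mul, mul_comm, pow_mul]; norm_num
      simp only [ε]
      rw [h4, pow_succ]
      field_simp
      ring
  have h1 := (Finset.sum_le_sum fun k (_ : k ∈ Finset.range m) => hS k).trans (hsum m)
  have h2 : ε m * ∫ ω, ‖Y ω‖ ∂μ ≤ 25 * (g * κ) * a := by
    refine (mul_le_mul_of_nonneg_left (integral_norm_le_of_exp_moment hY hκ hexp)
      (hε m).le).trans ?_
    simp only [ε]
    rw [ha2, div_mul_eq_mul_div, div_le_iff₀ (by positivity)]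
    have : 25 * (g * κ) * a * a ≤ 25 * (g * κ) * a * 2 ^ m := by gcongr
    linarith
  have h3 : 0 ≤ g * κ * 20 / 2 ^ m := by positivity
  have h4 : g * κ * (725 * 2 ^ m + 20) ≤ g * κ * (725 * (2 * a) + 20 * a) := by
    gcongr
    linarith
  have h5 : 0 ≤ g * κ * a := by positivity
  linarith

end Chaining

lemma integral_gauge_weighted_sum_le {n s : ℕ} [Nonempty (Fin n)]
    {C : Set (EuclideanSpace ℝ (Fin n))} (hC : IsConvexBody C) {L : ℝ} (hiso : IsIsotropic C L)
    {K : Set (EuclideanSpace ℝ (Fin n))} (hK : IsSymmConvexBody K) (t : Fin s → ℝ) :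
    ∫ x in Set.univ.pi fun _ : Fin s => C, gauge K (∑ j, t j • x j) ≤
      150000 * L * (n : ℝ) ^ ((1 : ℝ) / 4) * Real.sqrt n * sphereM K * euclNorm t := by
  have hL := hiso.2.2.1
  have ht : 0 ≤ euclNorm t := Real.sqrt_nonneg _
  have hM := sphereM_nonneg K
  let μ : Measure (Fin s → EuclideanSpace ℝ (Fin n)) :=
    volume.restrict (Set.univ.pi fun _ : Fin s => C)
  have : IsProbabilityMeasure μ := ⟨by simp [μ, volume_pi_pi, hiso.1]⟩
  let Y : (Fin s → EuclideanSpace ℝ (Fin n)) → EuclideanSpace ℝ (Fin n) := fun x => ∑ j, t j • x j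
  have hYc : Continuous Y := by fun_prop
  have hY : ∀ f : EuclideanSpace ℝ (Fin n) → ℝ, Continuous f →
      Integrable (fun x => f (Y x)) μ := fun f hf =>
    (hf.comp hYc).continuousOn.integrableOn_compact (isCompact_univ_pi fun _ => hC.2.1)
  have hbound : ∀ δ : ℝ, 0 < δ → ∫ x, gauge K (Y x) ∂μ ≤
      1500 * (Real.sqrt n * sphereM K + δ) * (100 * L * (euclNorm t + δ)) *
        (n : ℝ) ^ ((1 : ℝ) / 4) := by
    intro δ hδ
    have hκ : 0 < 100 * L * (euclNorm t + δ) := by positivity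
    refine integral_gauge_le_of_exp_moment hK (by positivity)
      ((integral_gauge_mul_gaussWeight_le K).trans ?_) hY hκ fun θ hθ => ?_
    · have := integral_gaussWeight_pos (n := n)
      gcongr
      linarith
    · simp_rw [div_eq_inv_mul]
      refine integral_exp_weighted_sum_le hC hiso t ?_ hθ
      rw [abs_of_pos (inv_pos.2 hκ), inv_mul_le_iff₀ hκ]
      nlinarith
  have hlim : Filter.Tendsto (fun δ : ℝ => 1500 * (Real.sqrt n * sphereM K + δ) *
      (100 * L * (euclNorm t + δ)) * (n : ℝ) ^ ((1 : ℝ) / 4)) (nhdsWithin 0 (Set.Ioi 0))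
      (nhds (1500 * (Real.sqrt n * sphereM K + 0) * (100 * L * (euclNorm t + 0)) *
        (n : ℝ) ^ ((1 : ℝ) / 4))) := by
    refine (Continuous.tendsto ?_ 0).mono_left nhdsWithin_le_nhds
    fun_prop
  refine (ge_of_tendsto hlim (Filter.mem_of_superset self_mem_nhdsWithin hbound)).trans_eq ?_
  ring

/-- there is an absolute constant `c > 0` such that for any isotropic convex
body `C` and any centrally symmetric convex body `K` in `ℝⁿ`, any `s ≥ 1` and `t ∈ ℝˢ`,
`∫_C⋯∫_C ‖∑ t_j x_j‖_K ≤ c L_C max{n^{1/4}, √(log(1+s))} √n M(K) ‖t‖₂`. -/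
theorem stmt9 :
    ∃ c : ℝ, 0 < c ∧
      ∀ (n s : ℕ) (_hs : 1 ≤ s)
        (C : Set (EuclideanSpace ℝ (Fin n))) (_hC : IsConvexBody C)
        (L : ℝ) (_hCiso : IsIsotropic C L)
        (K : Set (EuclideanSpace ℝ (Fin n))) (_hK : IsSymmConvexBody K)
        (t : Fin s → ℝ),
        (∫ x in Set.univ.pi fun _ : Fin s => C, gauge K (∑ j, t j • x j))
          ≤ c * L * max ((n : ℝ) ^ ((1 : ℝ) / 4)) (Real.sqrt (Real.log (1 + s)))
              * Real.sqrt n * sphereM K * euclNorm t := by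
  refine ⟨150000, by norm_num, fun n s _ C hC L hiso K hK t => ?_⟩
  rcases Nat.eq_zero_or_pos n with rfl | hn
  · simp [Subsingleton.elim _ (0 : EuclideanSpace ℝ (Fin 0))]
  · have : Nonempty (Fin n) := Fin.pos_iff_nonempty.1 hn
    have hL := hiso.2.2.1
    have hM := sphereM_nonneg K
    have ht : 0 ≤ euclNorm t := Real.sqrt_nonneg _
    refine (integral_gauge_weighted_sum_le hC hiso hK t).trans ?_
    gcongr
    exact le_max_left _ _
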